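/- Let k ≥ 4 be even, let s ∈ ℂ with 2 < Re(s) < k−1, and let z = (z₁,z₂) ∈ ℍ². Then Σ_{γ ∈ A\Γ} (γ₁z₁)^{−s}(γ₂z₂)^{−s}·j(γ,z)^{−k·1} = (2π)^{2s}/(e^{πis}·Γ(s)²·D^{1/2}) · Σ_{γ ∈ Γ∞⁺\Γ} j(γ,z)^{−k·1} · Σ_{ξ} (σ₁(ξ)σ₂(ξ))^{s−1}·exp(2πi(σ₁(ξ)·γ₁z₁ + σ₂(ξ)·γ₂z₂)), where the inner sum runs over the totally positive elements ξ of the inverse different 𝔡⁻¹, all summands are well defined on the respective coset spaces, and all series converge absolutely. -/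

import Mathlib

open Complex

noncomputable section

namespace HilbertPaper

/-- Möbius action of a real 2×2 matrix on a complex number. -/
def moebius (g : Matrix (Fin 2) (Fin 2) ℝ) (z : ℂ) : ℂ :=
  (((g 0 0 : ℝ) : ℂ) * z + ((g 0 1 : ℝ) : ℂ)) / (((g 1 0 : ℝ) : ℂ) * z + ((g 1 1 : ℝ) : ℂ))

/-- Automorphy factor `j(g, z) = c z + d`. -/
def jfac (g : Matrix (Fin 2) (Fin 2) ℝ) (z : ℂ) : ℂ :=
  ((g 1 0 : ℝ) : ℂ) * z + ((g 1 1 : ℝ) : ℂ)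

variable (F : Type) [Field F] [NumberField F]

/-- The embedding of the ring of integers into ℝ induced by a real embedding σ of F. -/
def emb (σ : F →+* ℝ) : NumberField.RingOfIntegers F →+* ℝ :=
  σ.comp (algebraMap (NumberField.RingOfIntegers F) F)

/-- An element of F is totally positive when both real embeddings are positive on it. -/
def TotPos (σ₁ σ₂ : F →+* ℝ) (x : F) : Prop := 0 < σ₁ x ∧ 0 < σ₂ x

/-- `F` is a real quadratic field with narrow class number one, whose two real embeddings
are `σ₁ ≠ σ₂`; narrow class number one is expressed as: every nonzero ideal of the ring of
integers has a totally positive generator. -/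
def RealQuadNarrowOne (σ₁ σ₂ : F →+* ℝ) : Prop :=
  Module.finrank ℚ F = 2 ∧ σ₁ ≠ σ₂ ∧
    ∀ I : Ideal (NumberField.RingOfIntegers F), I ≠ ⊥ →
      ∃ a : NumberField.RingOfIntegers F,
        TotPos F σ₁ σ₂ (algebraMap (NumberField.RingOfIntegers F) F a) ∧ I = Ideal.span {a}

/-- Γ = SL₂(O). -/
abbrev SL2O := Matrix.SpecialLinearGroup (Fin 2) (NumberField.RingOfIntegers F)

/-- The real matrix obtained from γ ∈ SL₂(O) by applying σ entrywise. -/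
def mat (σ : F →+* ℝ) (γ : SL2O F) : Matrix (Fin 2) (Fin 2) ℝ :=
  (γ : Matrix (Fin 2) (Fin 2) (NumberField.RingOfIntegers F)).map (emb F σ)

/-- Membership in the subgroup A = {diag(ε, ε⁻¹) : ε a totally positive unit}. -/
def IsInA (σ₁ σ₂ : F →+* ℝ) (a : SL2O F) : Prop :=
  ∃ ε : (NumberField.RingOfIntegers F)ˣ,
    TotPos F σ₁ σ₂ (algebraMap (NumberField.RingOfIntegers F) F (ε : NumberField.RingOfIntegers F)) ∧
    (a : Matrix (Fin 2) (Fin 2) (NumberField.RingOfIntegers F)) =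
      !![(ε : NumberField.RingOfIntegers F), 0; 0, ((ε⁻¹ : (NumberField.RingOfIntegers F)ˣ) : NumberField.RingOfIntegers F)]

/-- The relation on Γ whose quotient is the coset space A\Γ. -/
def ARel (σ₁ σ₂ : F →+* ℝ) (γ γ' : SL2O F) : Prop :=
  ∃ a : SL2O F, IsInA F σ₁ σ₂ a ∧ γ' = a * γ

/-- The summand of the Cohen kernel: (γ₁z₁)^{-s} (γ₂z₂)^{-s} j(γ,z)^{-k·1}. -/
def cohenSummand (σ₁ σ₂ : F →+* ℝ) (k : ℕ) (s : ℂ) (z₁ z₂ : ℂ) (γ : SL2O F) : ℂ :=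
  moebius (mat F σ₁ γ) z₁ ^ (-s) * moebius (mat F σ₂ γ) z₂ ^ (-s) *
    (jfac (mat F σ₁ γ) z₁ ^ (-(k : ℤ)) * jfac (mat F σ₂ γ) z₂ ^ (-(k : ℤ)))

/-- Membership in Γ∞⁺, the upper-triangular elements of Γ with totally positive diagonal. -/
def IsInGammaInfPos (σ₁ σ₂ : F →+* ℝ) (p : SL2O F) : Prop :=
  (p : Matrix (Fin 2) (Fin 2) (NumberField.RingOfIntegers F)) 1 0 = 0 ∧
  TotPos F σ₁ σ₂ (algebraMap (NumberField.RingOfIntegers F) F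
    ((p : Matrix (Fin 2) (Fin 2) (NumberField.RingOfIntegers F)) 0 0)) ∧
  TotPos F σ₁ σ₂ (algebraMap (NumberField.RingOfIntegers F) F
    ((p : Matrix (Fin 2) (Fin 2) (NumberField.RingOfIntegers F)) 1 1))

/-- The relation on Γ whose quotient is the coset space Γ∞⁺\Γ. -/
def GammaInfRel (σ₁ σ₂ : F →+* ℝ) (γ γ' : SL2O F) : Prop :=
  ∃ p : SL2O F, IsInGammaInfPos F σ₁ σ₂ p ∧ γ' = p * γ

/-- The relation on Γ × Γ whose quotient is (Γ∞⁺\Γ)². -/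
def PairRel (σ₁ σ₂ : F →+* ℝ) (p q : SL2O F × SL2O F) : Prop :=
  GammaInfRel F σ₁ σ₂ p.1 q.1 ∧ GammaInfRel F σ₁ σ₂ p.2 q.2

/-- `c_{γδ⁻¹}`, the lower-left entry of γδ⁻¹. -/
def lowc (γ δ : SL2O F) : NumberField.RingOfIntegers F :=
  ((γ * δ⁻¹ : SL2O F) : Matrix (Fin 2) (Fin 2) (NumberField.RingOfIntegers F)) 1 0

/-- The summand of the double Eisenstein series E_{s, k-s}(z; w). -/
def dblSummand (σ₁ σ₂ : F →+* ℝ) (k : ℕ) (s w : ℂ) (z₁ z₂ : ℂ) (γ δ : SL2O F) : ℂ :=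
  ((σ₁ (algebraMap (NumberField.RingOfIntegers F) F (lowc F γ δ)) : ℝ) : ℂ) ^ (w - 1) *
  ((σ₂ (algebraMap (NumberField.RingOfIntegers F) F (lowc F γ δ)) : ℝ) : ℂ) ^ (w - 1) *
  ((jfac (mat F σ₁ γ) z₁ / jfac (mat F σ₁ δ) z₁) ^ (-s) *
   (jfac (mat F σ₂ γ) z₂ / jfac (mat F σ₂ δ) z₂) ^ (-s)) *
  (jfac (mat F σ₁ δ) z₁ ^ (-(k : ℤ)) * jfac (mat F σ₂ δ) z₂ ^ (-(k : ℤ)))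

open Classical in
/-- The summand of the double Eisenstein series, extended by zero to pairs whose
`c_{γδ⁻¹}` is not totally positive. -/
def dblExt (σ₁ σ₂ : F →+* ℝ) (k : ℕ) (s w : ℂ) (z₁ z₂ : ℂ) (γ δ : SL2O F) : ℂ :=
  if TotPos F σ₁ σ₂ (algebraMap (NumberField.RingOfIntegers F) F (lowc F γ δ)) then
    dblSummand F σ₁ σ₂ k s w z₁ z₂ γ δ
  else 0

/-- Membership in the inverse different `𝔡⁻¹ = {ξ ∈ F : Tr_{F/ℚ}(ξ O) ⊆ ℤ}`. -/
def InInvDiff (ξ : F) : Prop :=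
  ∀ a : NumberField.RingOfIntegers F,
    ∃ n : ℤ, Algebra.trace ℚ F (ξ * algebraMap (NumberField.RingOfIntegers F) F a) = (n : ℚ)

/-- The totally positive elements of the inverse different. -/
abbrev InvDiffPos (σ₁ σ₂ : F →+* ℝ) := {ξ : F // InInvDiff F ξ ∧ TotPos F σ₁ σ₂ ξ}

/-- The inner summand `N(ξ)^{s-1} e^{2πi(σ₁(ξ)·γ₁z₁ + σ₂(ξ)·γ₂z₂)}`. -/
def innerSummand (σ₁ σ₂ : F →+* ℝ) (s : ℂ) (z₁ z₂ : ℂ) (γ : SL2O F)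
    (ξ : InvDiffPos F σ₁ σ₂) : ℂ :=
  ((σ₁ ξ.1 * σ₂ ξ.1 : ℝ) : ℂ) ^ (s - 1) *
    Complex.exp (2 * Real.pi * Complex.I *
      (((σ₁ ξ.1 : ℝ) : ℂ) * moebius (mat F σ₁ γ) z₁ +
       ((σ₂ ξ.1 : ℝ) : ℂ) * moebius (mat F σ₂ γ) z₂))

/-- The outer summand `j(γ,z)^{-k·1} Σ_ξ N(ξ)^{s-1} e^{2πi Tr(ξ·γz)}`. -/
def outerSummand (σ₁ σ₂ : F →+* ℝ) (k : ℕ) (s : ℂ) (z₁ z₂ : ℂ) (γ : SL2O F) : ℂ :=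
  (jfac (mat F σ₁ γ) z₁ ^ (-(k : ℤ)) * jfac (mat F σ₂ γ) z₂ ^ (-(k : ℤ))) *
    ∑' ξ : InvDiffPos F σ₁ σ₂, innerSummand F σ₁ σ₂ s z₁ z₂ γ ξ

set_option linter.unusedSectionVars false

section Poisson

open MeasureTheory Set

/-- The lattice translates of the half-open unit cube tile `ℝ^d`. -/
theorem integral_eq_tsum_cube {d : Type*} [Fintype d] {H : (d → ℝ) → ℂ} (hH : Integrable H) :
    ∫ x, H x = ∑' n : d → ℤ, ∫ x in {x : d → ℝ | ∀ i, x i ∈ Ioc (0 : ℝ) (0 + 1)},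
      H (x + fun i => (n i : ℝ)) := by
  set Q : Set (d → ℝ) := {x : d → ℝ | ∀ i, x i ∈ Ioc (0 : ℝ) (0 + 1)} with hQ
  have hQm : MeasurableSet Q := MeasurableSet.univ_pi' (fun i => measurableSet_Ioc)
  let T : (d → ℤ) → Set (d → ℝ) := fun n => (fun x => x - fun i => (n i : ℝ)) ⁻¹' Q
  have hTm : ∀ n, MeasurableSet (T n) := fun n => hQm.preimage (by fun_prop)
  have hd : Pairwise (Function.onFun Disjoint T) := by
    intro m n hmn
    refine Set.disjoint_left.2 fun x hx hy => hmn ?_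
    funext i
    have h1 := hx i
    have h2 := hy i
    simp only [Pi.sub_apply, mem_Ioc] at h1 h2
    have h3 : (m i : ℝ) < n i + 1 := by linarith
    have h4 : (n i : ℝ) < m i + 1 := by linarith
    norm_cast at h3 h4
    omega
  have hU : ⋃ n, T n = univ := by
    refine eq_univ_of_forall fun x => mem_iUnion.2 ⟨fun i => ⌈x i⌉ - 1, fun i => ?_⟩
    have h1 := Int.le_ceil (x i)
    have h2 := Int.ceil_lt_add_one (x i)
    simp only [Pi.sub_apply, mem_Ioc, Int.cast_sub, Int.cast_one]
    constructor <;> linarith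
  have key := integral_iUnion hTm hd (f := H) (μ := volume) hH.integrableOn
  rw [hU, setIntegral_univ] at key
  rw [key]
  refine tsum_congr fun n => ?_
  have := (measurePreserving_sub_right (volume : Measure (d → ℝ))
    (fun i => (n i : ℝ))).setIntegral_preimage_emb
    (MeasurableEquiv.subRight _).measurableEmbedding (fun x => H (x + fun i => (n i : ℝ))) Q
  simpa [T] using this

/-- **Poisson summation** on `ℤ^d`. -/
theorem poisson_summation_pi {d : Type*} [Fintype d] {G : (d → ℝ) → ℂ}
    (hG : Continuous G) (hGi : Integrable G)
    (hb : ∀ R : ℝ, ∃ u : (d → ℤ) → ℝ, Summable u ∧ ∀ x : d → ℝ, ‖x‖ ≤ R → ∀ n : d → ℤ,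
      ‖G (x + fun i => (n i : ℝ))‖ ≤ u n)
    (hs : Summable fun m : d → ℤ =>
      ∫ x : d → ℝ, (∏ i, cexp (-(2 * Real.pi * I * (m i * x i)))) * G x) :
    ∑' n : d → ℤ, G (fun i => (n i : ℝ)) = ∑' m : d → ℤ,
      ∫ x : d → ℝ, (∏ i, cexp (-(2 * Real.pi * I * (m i * x i)))) * G x := by
  let S : (d → ℝ) → ℂ := fun x => ∑' n : d → ℤ, G (x + fun i => (n i : ℝ))
  have hsum : ∀ x, Summable fun n : d → ℤ => G (x + fun i => (n i : ℝ)) := fun x => by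
    obtain ⟨u, hu, hle⟩ := hb ‖x‖
    exact .of_norm_bounded hu (hle x le_rfl)
  have hScont : Continuous S := by
    rw [continuous_iff_continuousAt]
    intro x
    obtain ⟨u, hu, hle⟩ := hb (‖x‖ + 1)
    have : ContinuousOn S (Metric.ball x 1) := by
      refine continuousOn_tsum (fun n => by fun_prop) hu fun n y hy => hle y ?_ n
      have h1 : ‖y - x‖ < 1 := by simpa [dist_eq_norm] using hy
      calc ‖y‖ = ‖x + (y - x)‖ := by simp
        _ ≤ ‖x‖ + 1 := (norm_add_le _ _).trans (by linarith)
    exact this.continuousAt (Metric.ball_mem_nhds x one_pos)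
  have hSper : ∀ x (m : d → ℤ), S (x + fun i => (m i : ℝ)) = S x := fun x m => by
    simp only [S]
    rw [← (Equiv.addLeft m).tsum_eq (fun n : d → ℤ => G (x + fun i => (n i : ℝ)))]
    refine tsum_congr fun n => ?_
    congr 1
    funext i
    simp [add_assoc]
  let P : UnitAddTorus d → ℂ := fun t => S fun i => (AddCircle.equivIoc 1 0 (t i) : ℝ)
  have hPS : ∀ x : d → ℝ, P (fun i => (x i : UnitAddCircle)) = S x := fun x => by
    have : ∀ i, ∃ m : ℤ, (AddCircle.equivIoc (1 : ℝ) 0 (x i : UnitAddCircle) : ℝ) = x i + m := by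
      intro i
      have h : (((AddCircle.equivIoc (1 : ℝ) 0 (x i : UnitAddCircle) : ℝ)) : UnitAddCircle)
          = (x i : UnitAddCircle) := (AddCircle.equivIoc (1 : ℝ) 0).symm_apply_apply _
      rw [← sub_eq_zero, ← AddCircle.coe_sub, AddCircle.coe_eq_zero_iff] at h
      obtain ⟨m, hm⟩ := h
      exact ⟨m, by simp only [zsmul_eq_mul, mul_one] at hm; linarith⟩
    choose m hm using this
    simp only [P]
    rw [← hSper x m]
    congr 1
    funext i
    simp [hm]
  have hPc : Continuous P := by
    have hq : IsOpenQuotientMap (Pi.map fun (_ : d) (x : ℝ) => (x : UnitAddCircle)) :=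
      IsOpenQuotientMap.piMap fun _ => QuotientAddGroup.isOpenQuotientMap_mk
    rw [hq.isQuotientMap.continuous_iff]
    exact hScont.congr fun x => (hPS x).symm
  have hcoeff : ∀ m : d → ℤ, UnitAddTorus.mFourierCoeff P m =
      ∫ x : d → ℝ, (∏ i, cexp (-(2 * Real.pi * I * (m i * x i)))) * G x := fun m => by
    set e : (d → ℝ) → ℂ := fun x => ∏ i, cexp (-(2 * Real.pi * I * (m i * x i))) with he
    have hec : Continuous e := by fun_prop
    have hen : ∀ x, ‖e x‖ = 1 := fun x => by
      simp only [he, norm_prod]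
      refine Finset.prod_eq_one fun i _ => ?_
      have := Complex.norm_exp_ofReal_mul_I (-(2 * Real.pi * (m i * x i)))
      rw [← this]; congr 2; push_cast; ring
    have heper : ∀ x (n : d → ℤ), e (x + fun i => (n i : ℝ)) = e x := fun x n => by
      refine Finset.prod_congr rfl fun i _ => ?_
      have := Complex.exp_int_mul_two_pi_mul_I (-(m i * n i))
      simp only [Pi.add_apply]
      rw [show -(2 * (Real.pi : ℂ) * I * ((m i : ℂ) * ((x i + n i : ℝ) : ℂ)))
        = -(2 * (Real.pi : ℂ) * I * (m i * x i)) + ((-(m i * n i) : ℤ) : ℂ) * (2 * Real.pi * I) by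
          push_cast; ring, Complex.exp_add, this, mul_one]
    have hi : Integrable fun x => e x * G x :=
      hGi.bdd_mul hec.aestronglyMeasurable (c := 1) (.of_forall fun x => (hen x).le)
    rw [UnitAddTorus.mFourierCoeff_eq_integral P m 0, integral_eq_tsum_cube hi]
    set Q : Set (d → ℝ) := {x : d → ℝ | ∀ i, x i ∈ Ioc (0 : ℝ) (0 + 1)} with hQ
    have hQm : MeasurableSet Q := MeasurableSet.univ_pi' (fun i => measurableSet_Ioc)
    obtain ⟨u, hu, hle⟩ := hb 1
    have hQ1 : ∀ x ∈ Q, ‖x‖ ≤ 1 := fun x hx => by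
      refine (pi_norm_le_iff_of_nonneg zero_le_one).2 fun i => ?_
      have := hx i
      simp only [zero_add, mem_Ioc] at this
      rw [Real.norm_eq_abs, abs_le]; constructor <;> linarith
    have hvol : volume Q < ⊤ := by
      refine (Metric.isBounded_iff_subset_closedBall 0).2 ⟨1, fun x hx => ?_⟩ |>.measure_lt_top
      simpa using hQ1 x hx
    have : IsFiniteMeasure (volume.restrict Q) := ⟨by simpa using hvol⟩
    have hfi : ∀ n : d → ℤ, Integrable (fun x => e x * G (x + fun i => (n i : ℝ)))
        (volume.restrict Q) := fun n => by
      refine Integrable.of_bound (by fun_prop) (u n) ?_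
      filter_upwards [ae_restrict_mem hQm] with x hx
      rw [norm_mul, hen, one_mul]
      exact hle x (hQ1 x hx) n
    have hts := integral_tsum_of_summable_integral_norm hfi ?_
    · simp only [heper]
      rw [hts]
      refine setIntegral_congr_fun hQm fun x hx => ?_
      simp only [hPS, S, smul_eq_mul, tsum_mul_left]
      congr 1
      simp only [UnitAddTorus.mFourier, ContinuousMap.coe_mk, he]
      refine Finset.prod_congr rfl fun i _ => ?_
      rw [fourier_coe_apply]
      congr 1
      simp
      ring
    · refine Summable.of_nonneg_of_le (fun n => integral_nonneg fun x => norm_nonneg _)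
        (fun n => ?_) (hu.mul_right (volume.real Q))
      have := norm_setIntegral_le_of_norm_le_const (μ := volume) (s := Q) (C := u n)
        (f := fun x => ‖e x * G (x + fun i => (n i : ℝ))‖) hvol ?_
      · exact (le_abs_self _).trans this
      · intro x hx
        rw [norm_norm, norm_mul, hen, one_mul]
        exact hle x (hQ1 x hx) n
  have hP := UnitAddTorus.hasSum_mFourier_series_apply_of_summable (f := ⟨P, hPc⟩)
    (by
      refine hs.congr fun m => ?_
      exact (hcoeff m).symm) (fun i => ((0 : ℝ) : UnitAddCircle))
  have h0 := hP.tsum_eq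
  simp only [ContinuousMap.coe_mk, hcoeff] at h0
  rw [hPS (fun _ => 0)] at h0
  simp only [S] at h0
  rw [show (fun _ : d => (0 : ℝ)) = 0 from rfl] at h0
  simp only [zero_add] at h0
  rw [← h0]
  refine tsum_congr fun m => ?_
  simp [UnitAddTorus.mFourier]
end Poisson

section LatticePoisson

open MeasureTheory Set

theorem integral_comp_mulVec {d : Type*} [Fintype d] [DecidableEq d] {B M : Matrix d d ℝ}
    (hMB : M.transpose * B = 1) {H : (d → ℝ) → ℂ} (hH : Continuous H) :
    ∫ x, H (B.mulVec x) = (|M.det| : ℝ) * ∫ y, H y := by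
  have hdet : M.det * B.det = 1 := by
    rw [← Matrix.det_transpose M, ← Matrix.det_mul, hMB, Matrix.det_one]
  have hB0 : B.det ≠ 0 := right_ne_zero_of_mul_eq_one hdet
  have hM : B.det⁻¹ = M.det := by field_simp; linarith
  have h := Real.map_matrix_volume_pi_eq_smul_volume_pi hB0
  have h2 := integral_map (μ := volume) (φ := Matrix.toLin' B) (f := H)
    (by have := LinearMap.continuous_of_finiteDimensional (Matrix.toLin' B); fun_prop)
    hH.aestronglyMeasurable
  rw [h, integral_smul_measure, hM] at h2
  simp only [Matrix.toLin'_apply] at h2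
  rw [← h2, ENNReal.toReal_ofReal (abs_nonneg _), Complex.real_smul]

theorem summable_int_inv_sq : Summable fun n : ℤ => ((1 + |(n : ℝ)|) ^ 2)⁻¹ := by
  refine Summable.of_norm_bounded_eventually (g := fun n : ℤ => 1 / (n : ℝ) ^ 2)
    (Real.summable_one_div_int_pow.2 one_lt_two) ?_
  filter_upwards [(Set.finite_singleton (0 : ℤ)).compl_mem_cofinite] with n hn
  have hn0 : 0 < |(n : ℝ)| := abs_pos.2 (by exact_mod_cast hn)
  rw [Real.norm_of_nonneg (by positivity), one_div, ← sq_abs (n : ℝ)]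
  gcongr
  linarith

theorem summable_fin_two_inv_sq :
    Summable fun n : Fin 2 → ℤ => ∏ i, ((1 + |(n i : ℝ)|) ^ 2)⁻¹ := by
  have := summable_int_inv_sq.mul_of_nonneg summable_int_inv_sq
    (fun _ => by positivity) (fun _ => by positivity)
  rw [← (finTwoArrowEquiv ℤ).symm.summable_iff]
  refine this.congr fun p => ?_
  simp [finTwoArrowEquiv, mul_comm]

/-- Decay of a product function along a lattice, locally uniformly in the translation. -/
theorem lattice_decay {B M : Matrix (Fin 2) (Fin 2) ℝ} (hMB : M.transpose * B = 1)
    {φ : Fin 2 → ℝ → ℂ} {C : ℝ} (hφ : ∀ i t, ‖φ i t‖ ≤ C * ((1 + |t|) ^ 4)⁻¹) (R : ℝ) :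
    ∃ K : ℝ, ∀ x : Fin 2 → ℝ, ‖x‖ ≤ R → ∀ n : Fin 2 → ℝ,
      ‖∏ i, φ i (B.mulVec (x + n) i)‖ ≤ K * ∏ i, ((1 + |n i|) ^ 2)⁻¹ := by
  have hC : 0 ≤ C := by simpa using (norm_nonneg _).trans (hφ 0 0)
  set A : ℝ := ∑ i, ∑ j, |M i j| with hA
  have hA0 : 0 ≤ A := by positivity
  refine ⟨C ^ 2 * ((1 + |R| + A) ^ 4), fun x hx n => ?_⟩
  set y := B.mulVec (x + n) with hy
  have hxn : M.transpose.mulVec y = x + n := by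
    rw [hy, Matrix.mulVec_mulVec, hMB, Matrix.one_mulVec]
  set Y := (1 + |y 0|) * (1 + |y 1|) with hY
  have hYi : ∀ i, |y i| ≤ Y := by
    intro i
    have := abs_nonneg (y 0)
    have := abs_nonneg (y 1)
    fin_cases i <;> simp only [hY, Fin.zero_eta, Fin.mk_one] <;> nlinarith
  have hY1 : 1 ≤ Y := by
    have := abs_nonneg (y 0)
    have := abs_nonneg (y 1)
    nlinarith
  have hn : ∀ i, 1 + |n i| ≤ (1 + |R| + A) * Y := by
    intro i
    have h1 : n i = M.transpose.mulVec y i - x i := by rw [hxn]; simp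
    have h2 : |M.transpose.mulVec y i| ≤ A * Y := by
      rw [Matrix.mulVec, dotProduct]
      refine (Finset.abs_sum_le_sum_abs _ _).trans ?_
      rw [hA, Finset.sum_mul]
      refine Finset.sum_le_sum fun j _ => ?_
      rw [abs_mul]
      refine mul_le_mul ?_ (hYi j) (abs_nonneg _) (by positivity)
      exact Finset.single_le_sum (f := fun i => |M j i|) (fun _ _ => abs_nonneg _)
        (Finset.mem_univ i)
    have h3 : |x i| ≤ |R| := (norm_le_pi_norm x i).trans (hx.trans (le_abs_self R))
    have h4 : |n i| ≤ A * Y + |R| := by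
      rw [h1]; exact (abs_sub _ _).trans (add_le_add h2 h3)
    nlinarith [abs_nonneg R]
  have hn2 : (1 + |n 0|) ^ 2 * (1 + |n 1|) ^ 2 ≤ (1 + |R| + A) ^ 4 * Y ^ 4 := by
    calc _ ≤ ((1 + |R| + A) * Y) ^ 2 * ((1 + |R| + A) * Y) ^ 2 := by
            gcongr
            · exact hn 0
            · exact hn 1
      _ = _ := by ring
  rw [Fin.prod_univ_two, Fin.prod_univ_two, norm_mul]
  calc _ ≤ (C * ((1 + |y 0|) ^ 4)⁻¹) * (C * ((1 + |y 1|) ^ 4)⁻¹) := by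
          gcongr
          · exact hφ 0 _
          · exact hφ 1 _
    _ = C ^ 2 * (Y ^ 4)⁻¹ := by rw [hY]; field_simp
    _ ≤ _ := by
      rw [mul_assoc]
      gcongr
      rw [← mul_inv, ← div_eq_mul_inv, le_div_iff₀ (by positivity), inv_mul_le_iff₀ (by positivity)]
      linarith

/-- Poisson summation for a product function along a lattice in the plane. -/
theorem poisson_lattice {B M : Matrix (Fin 2) (Fin 2) ℝ} (hMB : M.transpose * B = 1)
    {φ : Fin 2 → ℝ → ℂ} (hc : ∀ i, Continuous (φ i)) {C : ℝ}
    (hφ : ∀ i t, ‖φ i t‖ ≤ C * ((1 + |t|) ^ 4)⁻¹)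
    (hs : Summable fun m : Fin 2 → ℤ =>
      ∏ i, ∫ t : ℝ, cexp (-(2 * Real.pi * I * (M.mulVec (fun j => (m j : ℝ)) i * t))) * φ i t) :
    (Summable fun n : Fin 2 → ℤ => ∏ i, φ i (B.mulVec (fun j => (n j : ℝ)) i)) ∧
    ∑' n : Fin 2 → ℤ, ∏ i, φ i (B.mulVec (fun j => (n j : ℝ)) i) = (|M.det| : ℝ) *
      ∑' m : Fin 2 → ℤ,
        ∏ i, ∫ t : ℝ,
          cexp (-(2 * Real.pi * I * (M.mulVec (fun j => (m j : ℝ)) i * t))) * φ i t := by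
  have hφi : ∀ i, Integrable (φ i) := fun i => by
    refine Integrable.mono' ((integrable_inv_one_add_sq).const_mul C)
      (hc i).aestronglyMeasurable (.of_forall fun t => (hφ i t).trans ?_)
    have hC : 0 ≤ C := by simpa using (norm_nonneg _).trans (hφ 0 0)
    gcongr
    rw [← sq_abs t]
    nlinarith [abs_nonneg t, sq_nonneg (|t|), mul_nonneg (abs_nonneg t) (sq_nonneg |t|),
      pow_nonneg (abs_nonneg t) 4]
  have hGi0 : Integrable fun y : Fin 2 → ℝ => ∏ i, φ i (y i) :=
    Integrable.fintype_prod hφi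
  set G : (Fin 2 → ℝ) → ℂ := fun x => ∏ i, φ i (B.mulVec x i) with hG
  have hBc : Continuous fun x : Fin 2 → ℝ => B.mulVec x := by fun_prop
  have hGc : Continuous G := by fun_prop
  have hGi : Integrable G := by
    have hdet : M.det * B.det = 1 := by
      rw [← Matrix.det_transpose M, ← Matrix.det_mul, hMB, Matrix.det_one]
    have hB0 : B.det ≠ 0 := right_ne_zero_of_mul_eq_one hdet
    have h := Real.map_matrix_volume_pi_eq_smul_volume_pi hB0
    have h2 : Integrable (fun y : Fin 2 → ℝ => ∏ i, φ i (y i))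
        (Measure.map (Matrix.toLin' B) volume) := by
      rw [h]; exact hGi0.smul_measure (by simp)
    exact (integrable_map_measure h2.aestronglyMeasurable
      hBc.measurable.aemeasurable).1 h2
  have hb : ∀ R : ℝ, ∃ u : (Fin 2 → ℤ) → ℝ, Summable u ∧ ∀ x : Fin 2 → ℝ, ‖x‖ ≤ R →
      ∀ n : Fin 2 → ℤ, ‖G (x + fun i => (n i : ℝ))‖ ≤ u n := fun R => by
    obtain ⟨K, hK⟩ := lattice_decay hMB hφ R
    exact ⟨_, summable_fin_two_inv_sq.mul_left K, fun x hx n => hK x hx _⟩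
  have hcoef : ∀ m : Fin 2 → ℤ,
      ∫ x : Fin 2 → ℝ, (∏ i, cexp (-(2 * Real.pi * I * (m i * x i)))) * G x
      = (|M.det| : ℝ) * ∏ i, ∫ t : ℝ,
        cexp (-(2 * Real.pi * I * (M.mulVec (fun j => (m j : ℝ)) i * t))) * φ i t := fun m => by
    rw [← integral_fintype_prod_volume_eq_prod
      (fun i (t : ℝ) => cexp (-(2 * Real.pi * I * (M.mulVec (fun j => (m j : ℝ)) i * t))) * φ i t),
      ← integral_comp_mulVec hMB (by fun_prop)]
    congr 1
    funext x
    simp only [Finset.prod_mul_distrib, hG]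
    congr 1
    rw [← Complex.exp_sum, ← Complex.exp_sum]
    congr 1
    rw [Finset.sum_neg_distrib, Finset.sum_neg_distrib, ← Finset.mul_sum, ← Finset.mul_sum]
    congr 2
    have h1 : (fun j => (m j : ℝ)) ⬝ᵥ x = (M.mulVec fun j => (m j : ℝ)) ⬝ᵥ B.mulVec x := by
      rw [Matrix.dotProduct_mulVec, ← Matrix.mulVec_transpose, Matrix.mulVec_mulVec]
      rw [show B.transpose * M = 1 by
        rw [← Matrix.transpose_transpose M, ← Matrix.transpose_mul, hMB, Matrix.transpose_one]]
      rw [Matrix.one_mulVec]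
    have h2 := congrArg (fun r : ℝ => (r : ℂ)) h1
    simpa [dotProduct] using h2
  have hP := poisson_summation_pi hGc hGi hb (by
    refine (hs.mul_left ((|M.det| : ℝ) : ℂ)).congr fun m => (hcoef m).symm)
  refine ⟨?_, ?_⟩
  · obtain ⟨u, hu, hle⟩ := hb 0
    refine Summable.of_norm_bounded hu fun n => ?_
    have := hle 0 (by simp) n
    rwa [zero_add] at this
  · simp only [hcoef, tsum_mul_left] at hP
    exact hP

end LatticePoisson

section GammaIntegral

open MeasureTheory Set Filter Topology

theorem integrableOn_cpow_mul_exp {a r : ℂ} (ha : 0 < a.re) (hr : 0 < r.re) :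
    IntegrableOn (fun t : ℝ => (t : ℂ) ^ (a - 1) * cexp (-(r * t))) (Ioi 0) := by
  have h := integrableOn_rpow_mul_exp_neg_mul_rpow (s := a.re - 1) (p := 1) (by linarith) one_pos hr
  refine Integrable.mono' h ?_ ?_
  · refine ContinuousOn.aestronglyMeasurable (fun t ht => ?_) measurableSet_Ioi
    refine ContinuousAt.continuousWithinAt ?_
    have : ContinuousAt (fun t : ℝ => (t : ℂ) ^ (a - 1)) t :=
      Complex.continuousAt_ofReal_cpow_const _ _ (Or.inr (ne_of_gt ht))
    fun_prop
  · filter_upwards [ae_restrict_mem measurableSet_Ioi] with t ht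
    rw [norm_mul, Complex.norm_cpow_eq_rpow_re_of_pos ht, Complex.norm_exp]
    simp

/-- Euler's integral for `Γ(a) r^{-a}`, for a complex frequency `r` in the right half plane. -/
theorem integral_cpow_mul_exp_neg_complex_mul {a r : ℂ} (ha : 0 < a.re) (hr : 0 < r.re) :
    ∫ t in Ioi (0 : ℝ), (t : ℂ) ^ (a - 1) * cexp (-(r * t)) = (1 / r) ^ a * Complex.Gamma a := by
  set J : ℂ → ℂ := fun r => ∫ t in Ioi (0 : ℝ), (t : ℂ) ^ (a - 1) * cexp (-(r * t)) with hJ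
  set U : Set ℂ := {r | 0 < r.re} with hU
  have hUo : IsOpen U := isOpen_lt continuous_const Complex.continuous_re
  have hd : DifferentiableOn ℂ J U := fun r₀ hr₀ => by
    refine DifferentiableAt.differentiableWithinAt ?_
    have hr0 : 0 < r₀.re := hr₀
    have hmeas : ∀ (b r : ℂ), 0 < r.re → 0 < b.re → AEStronglyMeasurable
        (fun t : ℝ => (t : ℂ) ^ (b - 1) * cexp (-(r * t))) (volume.restrict (Ioi 0)) :=
      fun b r hr hb => (integrableOn_cpow_mul_exp hb hr).aestronglyMeasurable
    have h := hasDerivAt_integral_of_dominated_loc_of_deriv_le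
      (μ := volume.restrict (Ioi (0 : ℝ)))
      (F := fun r (t : ℝ) => (t : ℂ) ^ (a - 1) * cexp (-(r * t)))
      (F' := fun r (t : ℝ) => -((t : ℂ) ^ (a + 1 - 1) * cexp (-(r * t)))) (x₀ := r₀)
      (s := {r : ℂ | r₀.re / 2 < r.re})
      (bound := fun t : ℝ => t ^ a.re * Real.exp (-(r₀.re / 2) * t ^ (1 : ℝ)))
      ((isOpen_lt continuous_const Complex.continuous_re).mem_nhds (by
        change r₀.re / 2 < r₀.re; linarith))
      (by
        filter_upwards [hUo.mem_nhds hr₀] with r hr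
        exact hmeas a r hr ha)
      (integrableOn_cpow_mul_exp ha hr0)
      ((hmeas (a + 1) r₀ hr0 (by simp; linarith)).neg)
      (by
        filter_upwards [ae_restrict_mem measurableSet_Ioi] with t ht r hr
        have ht' : 0 < t := ht
        replace hr : r₀.re / 2 < r.re := hr
        rw [norm_neg, norm_mul, Complex.norm_cpow_eq_rpow_re_of_pos ht, Complex.norm_exp]
        simp only [add_sub_cancel_right, Real.rpow_one]
        gcongr
        simp
        nlinarith)
      (integrableOn_rpow_mul_exp_neg_mul_rpow (by linarith) one_pos (by linarith))
      (by
        filter_upwards [ae_restrict_mem measurableSet_Ioi] with t ht r hr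
        have ht0 : (t : ℂ) ≠ 0 := by
          have ht' : 0 < t := ht
          exact_mod_cast ht'.ne'
        have h1 : HasDerivAt (fun r : ℂ => cexp (-(r * t))) (cexp (-(r * t)) * -(1 * t)) r :=
          ((hasDerivAt_id r).mul_const (t : ℂ)).neg.cexp
        convert! h1.const_mul ((t : ℂ) ^ (a - 1)) using 1
        rw [show a + 1 - 1 = a - 1 + 1 by ring, Complex.cpow_add _ _ ht0, Complex.cpow_one]
        ring)
    exact h.2.differentiableAt
  have hd2 : DifferentiableOn ℂ (fun r : ℂ => (1 / r) ^ a * Complex.Gamma a) U := fun r hr => by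
    have hr' : 0 < r.re := hr
    have hr0 : r ≠ 0 := fun h => by simp [h] at hr'
    refine DifferentiableAt.differentiableWithinAt ?_
    have h1 : DifferentiableAt ℂ (fun r : ℂ => 1 / r) r := by fun_prop (disch := assumption)
    refine (h1.cpow (differentiableAt_const a) ?_).mul_const _
    rw [one_div]
    refine Complex.mem_slitPlane_iff.2 (Or.inl ?_)
    rw [Complex.inv_re]
    exact div_pos hr' (Complex.normSq_pos.2 hr0)
  have hconv : IsPreconnected U :=
    (convex_halfSpace_re_gt 0).isPreconnected
  refine (hd.analyticOnNhd hUo).eqOn_of_preconnected_of_frequently_eq (hd2.analyticOnNhd hUo)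
    hconv (z₀ := 1) (by simp [hU]) ?_ hr
  have ht : Tendsto (fun n : ℕ => ((1 + 1 / ((n : ℝ) + 1) : ℝ) : ℂ)) atTop (𝓝[≠] 1) := by
    refine tendsto_nhdsWithin_iff.2 ⟨?_, .of_forall fun n => ?_⟩
    · have h1 := (tendsto_one_div_add_atTop_nhds_zero_nat (𝕜 := ℝ)).const_add 1
      have h2 := (Complex.continuous_ofReal.tendsto _).comp h1
      simpa [Function.comp_def] using h2
    · have : (0 : ℝ) < 1 / ((n : ℝ) + 1) := by positivity
      intro h
      have h3 := congrArg Complex.re h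
      simp only [Complex.ofReal_re, Complex.one_re] at h3
      linarith
  refine ht.frequently (Frequently.of_forall fun n => ?_)
  have := Complex.integral_cpow_mul_exp_neg_mul_Ioi (a := a) (r := 1 + 1 / ((n : ℝ) + 1)) ha
    (by positivity)
  exact this

end GammaIntegral

section Lipschitz

open MeasureTheory Set

/-- `t^{s-1} e^{2πitw}` for `t > 0`, extended by zero. -/
def gammaKernel (s w : ℂ) (t : ℝ) : ℂ :=
  ((max t 0 : ℝ) : ℂ) ^ (s - 1) * cexp (2 * Real.pi * I * (t * w))

theorem continuous_gammaKernel {s : ℂ} (hs : 1 < s.re) (w : ℂ) :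
    Continuous (gammaKernel s w) := by
  have h : Continuous fun x : ℝ => (x : ℂ) ^ (s - 1) :=
    Complex.continuous_ofReal_cpow_const (by simpa using hs)
  have h2 : Continuous fun t : ℝ => ((max t 0 : ℝ) : ℂ) ^ (s - 1) :=
    h.comp (continuous_id.max continuous_const)
  unfold gammaKernel
  fun_prop

theorem gammaKernel_of_nonpos {s : ℂ} (hs : 1 < s.re) (w : ℂ) {t : ℝ} (ht : t ≤ 0) :
    gammaKernel s w t = 0 := by
  have : s - 1 ≠ 0 := fun h => by
    have := congrArg Complex.re h
    simp at this
    linarith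
  rw [gammaKernel, max_eq_right ht, Complex.ofReal_zero, Complex.zero_cpow this, zero_mul]

theorem gammaKernel_of_pos {s : ℂ} (w : ℂ) {t : ℝ} (ht : 0 < t) :
    gammaKernel s w t = (t : ℂ) ^ (s - 1) * cexp (2 * Real.pi * I * (t * w)) := by
  rw [gammaKernel, max_eq_left ht.le]

theorem gammaKernel_decay {s : ℂ} (hs : 1 < s.re) {w : ℂ} (hw : 0 < w.im) :
    ∃ C : ℝ, ∀ t, ‖gammaKernel s w t‖ ≤ C * ((1 + |t|) ^ 4)⁻¹ := by
  set b := 2 * Real.pi * w.im with hb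
  have hb0 : 0 < b := by positivity
  set p := s.re + 3 with hp
  have hp0 : 0 < p := by linarith
  refine ⟨(p / b) ^ p * Real.exp b, fun t => ?_⟩
  rcases le_or_gt t 0 with ht | ht
  · rw [gammaKernel_of_nonpos hs w ht, norm_zero]; positivity
  · rw [gammaKernel_of_pos w ht, norm_mul, Complex.norm_cpow_eq_rpow_re_of_pos ht,
      Complex.norm_exp, abs_of_pos ht, ← div_eq_mul_inv, le_div_iff₀ (by positivity)]
    have h1 : (2 * Real.pi * I * (t * w)).re = -(b * t) := by
      simp [hb]; ring
    rw [h1, Complex.sub_re, Complex.one_re, Real.exp_neg]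
    have h2 : t ^ (s.re - 1) * (1 + t) ^ 4 ≤ (1 + t) ^ p := by
      calc _ ≤ (1 + t) ^ (s.re - 1) * (1 + t) ^ (4 : ℝ) := by
              rw [← Real.rpow_natCast (1 + t) 4]
              gcongr
              · norm_num
              · linarith
              · norm_num
        _ = _ := by rw [← Real.rpow_add (by linarith), hp]; congr 1; ring
    have h3 : (1 + t) ^ p ≤ (p / b) ^ p * Real.exp (b * (1 + t)) := by
      have h4 : b / p * (1 + t) ≤ Real.exp (b / p * (1 + t)) := by
        linarith [Real.add_one_le_exp (b / p * (1 + t))]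
      have h5 : 1 + t ≤ p / b * Real.exp (b / p * (1 + t)) := by
        calc 1 + t = p / b * (b / p * (1 + t)) := by field_simp
          _ ≤ _ := by gcongr
      calc _ ≤ (p / b * Real.exp (b / p * (1 + t))) ^ p := by gcongr
        _ = _ := by
          rw [Real.mul_rpow (by positivity) (by positivity), ← Real.exp_mul]
          congr 2; field_simp
    calc _ = t ^ (s.re - 1) * (1 + t) ^ 4 * (Real.exp (b * t))⁻¹ := by ring
      _ ≤ (p / b) ^ p * Real.exp (b * (1 + t)) * (Real.exp (b * t))⁻¹ := by
        exact mul_le_mul_of_nonneg_right (h2.trans h3) (by positivity)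
      _ = _ := by
        rw [mul_add, mul_one, Real.exp_add]
        field_simp

theorem one_div_cpow_of_upperHalf (s : ℂ) {W : ℂ} (hW : 0 < W.im) :
    (1 / (-(2 * Real.pi * I * W))) ^ s
      = ((2 * Real.pi : ℝ) : ℂ) ^ (-s) * cexp (Real.pi * I * s / 2) * W ^ (-s) := by
  have hW0 : W ≠ 0 := fun h => by simp [h] at hW
  have hpi : (0 : ℝ) < 2 * Real.pi := by positivity
  have hpi0 : ((2 * Real.pi : ℝ) : ℂ) ≠ 0 := by exact_mod_cast hpi.ne'
  set x : ℂ := Complex.log ((2 * Real.pi : ℝ) : ℂ) + Complex.log W + -(Real.pi / 2 * I) with hx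
  have hexp : cexp x = -(2 * Real.pi * I * W) := by
    rw [hx, Complex.exp_add, Complex.exp_add, Complex.exp_log hpi0, Complex.exp_log hW0,
      Complex.exp_neg, Complex.exp_pi_div_two_mul_I]
    simp; ring
  have him : x.im = W.arg - Real.pi / 2 := by
    rw [hx, ← Complex.ofReal_log hpi.le]
    simp [Complex.log_im]; ring
  have h1 : 0 ≤ W.arg := Complex.arg_nonneg_iff.2 hW.le
  have h2 : W.arg < Real.pi := Complex.arg_lt_pi_iff.2 (Or.inr hW.ne')
  have hlog : Complex.log (-(2 * Real.pi * I * W)) = x := by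
    rw [← hexp, Complex.log_exp] <;> rw [him] <;> linarith [Real.pi_pos]
  have hne : -(2 * Real.pi * I * W) ≠ 0 := by rw [← hexp]; exact Complex.exp_ne_zero _
  rw [one_div, Complex.cpow_def_of_ne_zero (inv_ne_zero hne), Complex.log_inv, hlog,
    Complex.cpow_def_of_ne_zero hpi0, Complex.cpow_def_of_ne_zero hW0, ← Complex.exp_add,
    ← Complex.exp_add]
  · congr 1; rw [hx]; ring
  · rw [← Complex.log_im, hlog, him]; linarith [Real.pi_pos]

theorem fourier_gammaKernel {s : ℂ} (hs : 1 < s.re) {w : ℂ} (hw : 0 < w.im) (η : ℝ) :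
    ∫ t : ℝ, cexp (-(2 * Real.pi * I * (η * t))) * gammaKernel s w t
      = Complex.Gamma s * ((2 * Real.pi : ℝ) : ℂ) ^ (-s) * cexp (Real.pi * I * s / 2) *
        (w - η) ^ (-s) := by
  have hW : 0 < (w - η).im := by simpa using hw
  have h := integral_cpow_mul_exp_neg_complex_mul (a := s)
    (r := -(2 * Real.pi * I * (w - η))) (by linarith) (by
      have : (-(2 * Real.pi * I * (w - η))).re = 2 * Real.pi * w.im := by simp
      rw [this]; positivity)
  rw [one_div_cpow_of_upperHalf s hW] at h
  have h2 : ∫ t : ℝ, cexp (-(2 * Real.pi * I * (η * t))) * gammaKernel s w t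
      = ∫ t in Ioi (0 : ℝ), (t : ℂ) ^ (s - 1) * cexp (-(-(2 * Real.pi * I * (w - η)) * t)) := by
    rw [← integral_indicator measurableSet_Ioi]
    congr 1
    funext t
    rcases le_or_gt t 0 with ht | ht
    · rw [gammaKernel_of_nonpos hs w ht, mul_zero, indicator_of_notMem (by simpa using ht)]
    · rw [gammaKernel_of_pos w ht, indicator_of_mem (by simpa using ht), mul_left_comm,
        ← Complex.exp_add]
      congr 2
      ring
  rw [h2, h]
  ring

/-- The **Lipschitz summation formula** for a planar lattice. -/
theorem lipschitz_lattice {B M : Matrix (Fin 2) (Fin 2) ℝ} (hMB : M.transpose * B = 1)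
    {s : ℂ} (hs : 1 < s.re) {w : Fin 2 → ℂ} (hw : ∀ i, 0 < (w i).im)
    (hsum : Summable fun m : Fin 2 → ℤ => ∏ i, (w i + M.mulVec (fun j => (m j : ℝ)) i) ^ (-s)) :
    (Summable fun n : Fin 2 → ℤ =>
      ∏ i, gammaKernel s (w i) (B.mulVec (fun j => (n j : ℝ)) i)) ∧
    ∑' n : Fin 2 → ℤ, ∏ i, gammaKernel s (w i) (B.mulVec (fun j => (n j : ℝ)) i)
      = (|M.det| : ℝ) * (Complex.Gamma s ^ 2 * cexp (Real.pi * I * s) /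
        ((2 * Real.pi : ℝ) : ℂ) ^ (2 * s)) *
      ∑' m : Fin 2 → ℤ, ∏ i, (w i + M.mulVec (fun j => (m j : ℝ)) i) ^ (-s) := by
  choose C hC using fun i => gammaKernel_decay hs (hw i)
  have hpi0 : ((2 * Real.pi : ℝ) : ℂ) ≠ 0 := by
    exact_mod_cast (by positivity : (0 : ℝ) < 2 * Real.pi).ne'
  have hneg : ∀ (m : Fin 2 → ℤ) i, M.mulVec (fun j => ((-m) j : ℝ)) i
      = -M.mulVec (fun j => (m j : ℝ)) i := fun m i => by
    rw [← Pi.neg_apply, ← Matrix.mulVec_neg]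
    congr 2
    funext j
    simp
  set c := Complex.Gamma s ^ 2 * cexp (Real.pi * I * s) / ((2 * Real.pi : ℝ) : ℂ) ^ (2 * s) with hc
  have hterm : ∀ m : Fin 2 → ℤ, (∏ i, ∫ t : ℝ,
      cexp (-(2 * Real.pi * I * (M.mulVec (fun j => (m j : ℝ)) i * t))) * gammaKernel s (w i) t)
      = c * ∏ i, (w i + M.mulVec (fun j => ((-m) j : ℝ)) i) ^ (-s) := fun m => by
    simp only [fourier_gammaKernel hs (hw _), hneg, Fin.prod_univ_two, Complex.ofReal_neg,
      ← sub_eq_add_neg]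
    rw [hc, show Real.pi * I * s = Real.pi * I * s / 2 + Real.pi * I * s / 2 by ring,
      Complex.exp_add, two_mul s, Complex.cpow_add _ _ hpi0, Complex.cpow_neg]
    simp only [div_eq_mul_inv, mul_inv]
    ring_nf
  have hsum' : Summable fun m : Fin 2 → ℤ =>
      ∏ i, (w i + M.mulVec (fun j => ((-m) j : ℝ)) i) ^ (-s) :=
    (Equiv.neg (Fin 2 → ℤ)).summable_iff.2 hsum
  have h := poisson_lattice hMB (φ := fun i => gammaKernel s (w i))
    (fun i => continuous_gammaKernel hs (w i)) (C := max (C 0) (C 1)) (fun i t => by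
      refine (hC i t).trans ?_
      gcongr
      fin_cases i
      · exact le_max_left _ _
      · exact le_max_right _ _)
    ((hsum'.mul_left c).congr fun m => (hterm m).symm)
  refine ⟨h.1, h.2.trans ?_⟩
  simp only [hterm, tsum_mul_left]
  rw [mul_assoc]
  congr 2
  exact (Equiv.neg (Fin 2 → ℤ)).tsum_eq
    fun m : Fin 2 → ℤ => ∏ i, (w i + M.mulVec (fun j => (m j : ℝ)) i) ^ (-s)

end Lipschitz

section BoxCounting

open Set
open scoped ENNReal

/-- The majorant `max(1,|t|)^{-τ}`. -/
def decay (τ t : ℝ) : ℝ := max 1 |t| ^ (-τ)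

theorem decay_nonneg (τ t : ℝ) : 0 ≤ decay τ t := by unfold decay; positivity

theorem decay_le_floor {τ : ℝ} (hτ : 0 < τ) (t : ℝ) :
    decay τ t ≤ 3 ^ τ * (1 + |(⌊t⌋ : ℝ)|) ^ (-τ) := by
  have h1 := Int.floor_le t
  have h2 := Int.lt_floor_add_one t
  have h3 : |(⌊t⌋ : ℝ)| ≤ |t| + 1 := by
    rw [abs_le]; constructor <;> cases abs_cases t <;> linarith
  have h4 : 1 + |(⌊t⌋ : ℝ)| ≤ 3 * max 1 |t| := by
    linarith [le_max_left 1 |t|, le_max_right 1 |t|]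
  have h5 : 0 < max 1 |t| := lt_max_of_lt_left one_pos
  rw [decay, Real.rpow_neg h5.le, Real.rpow_neg (by positivity), ← div_eq_mul_inv,
    inv_eq_one_div, div_le_div_iff₀ (by positivity) (by positivity), one_mul,
    ← Real.mul_rpow (by norm_num) h5.le]
  gcongr

theorem summable_one_add_abs_int_rpow {τ : ℝ} (hτ : 1 < τ) :
    Summable fun n : ℤ => (1 + |(n : ℝ)|) ^ (-τ) := by
  refine Summable.of_norm_bounded_eventually (Real.summable_abs_int_rpow hτ) ?_
  filter_upwards [(Set.finite_singleton (0 : ℤ)).compl_mem_cofinite] with n hn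
  have hn0 : 0 < |(n : ℝ)| := abs_pos.2 (by exact_mod_cast hn)
  rw [Real.norm_of_nonneg (by positivity)]
  exact Real.rpow_le_rpow_of_nonpos hn0 (by linarith) (by linarith)

/-- Sums of `decay` over a family of points of the plane no two of which lie in a common
translate of a unit box are bounded uniformly in the translation. -/
theorem exists_tsum_decay_le {τ : ℝ} (hτ : 1 < τ) :
    ∃ C : ℝ≥0∞, C ≠ ⊤ ∧ ∀ {ι : Type} (u v : ι → ℝ),
      (∀ i j, i ≠ j → 1 ≤ |u i - u j| * |v i - v j|) → ∀ x y : ℝ,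
      ∑' i, ENNReal.ofReal (decay τ (x + u i) * decay τ (y + v i)) ≤ C := by
  set h : ℤ → ℝ := fun n => 3 ^ τ * (1 + |(n : ℝ)|) ^ (-τ) with hh
  have hh0 : ∀ n, 0 ≤ h n := fun n => by positivity
  have hsum : Summable h := (summable_one_add_abs_int_rpow hτ).mul_left _
  have hsum2 : Summable fun p : ℤ × ℤ => h p.1 * h p.2 :=
    hsum.mul_of_nonneg hsum hh0 hh0
  refine ⟨∑' p : ℤ × ℤ, ENNReal.ofReal (h p.1 * h p.2), hsum2.tsum_ofReal_ne_top, ?_⟩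
  intro ι u v huv x y
  have hinj : Function.Injective fun i => (⌊x + u i⌋, ⌊y + v i⌋) := by
    intro i j hij
    by_contra hne
    have h0 := huv i j hne
    simp only [Prod.mk.injEq] at hij
    have h1 := Int.abs_sub_lt_one_of_floor_eq_floor hij.1
    have h2 := Int.abs_sub_lt_one_of_floor_eq_floor hij.2
    rw [add_sub_add_left_eq_sub] at h1 h2
    nlinarith [abs_nonneg (u i - u j), abs_nonneg (v i - v j)]
  refine le_trans (ENNReal.tsum_le_tsum fun i => ?_)
    (ENNReal.tsum_comp_le_tsum_of_injective hinj fun p => ENNReal.ofReal (h p.1 * h p.2))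
  refine ENNReal.ofReal_le_ofReal ?_
  exact mul_le_mul (decay_le_floor (by linarith) _) (decay_le_floor (by linarith) _)
    (decay_nonneg _ _) (hh0 _)

theorem norm_rpow_neg_le_decay {τ : ℝ} (hτ : 0 < τ) {w : ℂ} {κ : ℝ} (hκ : 0 < κ) (hκ1 : κ ≤ 1)
    (hw : κ ≤ ‖w‖) : ‖w‖ ^ (-τ) ≤ κ ^ (-τ) * decay τ w.re := by
  rw [decay, ← Real.mul_rpow hκ.le (by positivity)]
  refine Real.rpow_le_rpow_of_nonpos (by positivity) ?_ (by linarith)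
  rw [mul_max_of_nonneg _ _ hκ.le, mul_one]
  refine max_le hw ?_
  have := Complex.abs_re_le_norm w
  nlinarith [abs_nonneg w.re]

theorem norm_mul_rpow_neg_le_decay {τ : ℝ} (hτ : 0 < τ) {w₁ w₂ : ℂ} (h₁ : 0 < w₁.im)
    (h₂ : 0 < w₂.im) (h : 1 ≤ ‖w₁‖ * ‖w₂‖) :
    (‖w₁‖ * ‖w₂‖) ^ (-τ) ≤
      (1 + w₁.im ^ (-τ) + w₂.im ^ (-τ)) * (decay τ w₁.re * decay τ w₂.re) := by
  have hone : ∀ w : ℂ, 1 ≤ ‖w‖ → ‖w‖ ^ (-τ) ≤ decay τ w.re := fun w hw => by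
    simpa using norm_rpow_neg_le_decay hτ one_pos le_rfl hw
  have hsmall : ∀ w : ℂ, 0 < w.im → ‖w‖ < 1 → ‖w‖ ^ (-τ) ≤ w.im ^ (-τ) * decay τ w.re :=
    fun w hw0 hw => by
    have h1 : decay τ w.re = 1 := by
      rw [decay, max_eq_left ((Complex.abs_re_le_norm w).trans hw.le), Real.one_rpow]
    rw [h1, mul_one]
    exact Real.rpow_le_rpow_of_nonpos hw0 ((le_abs_self _).trans (Complex.abs_im_le_norm w))
      (by linarith)
  have d₁ := decay_nonneg τ w₁.re
  have d₂ := decay_nonneg τ w₂.re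
  have i₁ : 0 ≤ w₁.im ^ (-τ) := by positivity
  have i₂ : 0 ≤ w₂.im ^ (-τ) := by positivity
  rw [Real.mul_rpow (norm_nonneg _) (norm_nonneg _)]
  rcases lt_or_ge ‖w₁‖ 1 with hw₁ | hw₁
  · have hw₂ : 1 ≤ ‖w₂‖ := by nlinarith [norm_nonneg w₂]
    calc _ ≤ (w₁.im ^ (-τ) * decay τ w₁.re) * decay τ w₂.re := by
          gcongr
          · exact hsmall _ h₁ hw₁
          · exact hone _ hw₂
      _ = w₁.im ^ (-τ) * (decay τ w₁.re * decay τ w₂.re) := by ring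
      _ ≤ _ := by gcongr; linarith
  · rcases lt_or_ge ‖w₂‖ 1 with hw₂ | hw₂
    · calc _ ≤ decay τ w₁.re * (w₂.im ^ (-τ) * decay τ w₂.re) := by
            gcongr
            · exact hone _ hw₁
            · exact hsmall _ h₂ hw₂
        _ = w₂.im ^ (-τ) * (decay τ w₁.re * decay τ w₂.re) := by ring
        _ ≤ _ := by gcongr; linarith
    · calc _ ≤ 1 * (decay τ w₁.re * decay τ w₂.re) := by
            rw [one_mul]
            gcongr
            · exact hone _ hw₁
            · exact hone _ hw₂
        _ ≤ _ := by gcongr; linarith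

theorem norm_cpow_neg_le (s : ℂ) {w : ℂ} (hw : w ≠ 0) :
    ‖w ^ (-s)‖ ≤ Real.exp (Real.pi * |s.im|) * ‖w‖ ^ (-s.re) := by
  rw [Complex.norm_cpow_of_ne_zero hw, Complex.neg_re, Complex.neg_im, div_eq_mul_inv,
    ← Real.exp_neg, mul_comm]
  gcongr
  calc -(w.arg * -s.im) ≤ |w.arg * s.im| := by rw [mul_neg, neg_neg]; exact le_abs_self _
    _ = |w.arg| * |s.im| := abs_mul _ _
    _ ≤ _ := by gcongr; exact Complex.abs_arg_le_pi w

end BoxCounting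

section QuadraticField

variable {F} {σ₁ σ₂ : F →+* ℝ}

open NumberField

/-- A real embedding of a number field, viewed as a `ℚ`-algebra map into `ℂ`. -/
def complexEmb (σ : F →+* ℝ) : F →ₐ[ℚ] ℂ := (Complex.ofRealHom.comp σ).toRatAlgHom

lemma complexEmb_apply (σ : F →+* ℝ) (x : F) : complexEmb σ x = ((σ x : ℝ) : ℂ) := rfl

lemma complexEmb_ne (hne : σ₁ ≠ σ₂) : complexEmb σ₁ ≠ complexEmb σ₂ := by
  intro h
  apply hne
  ext x
  have := congrArg (fun τ => τ x) h
  simpa [complexEmb_apply] using this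

open Classical in
lemma univ_eq_complexEmb (h2 : Module.finrank ℚ F = 2) (hne : σ₁ ≠ σ₂) :
    (Finset.univ : Finset (F →ₐ[ℚ] ℂ)) = {complexEmb σ₁, complexEmb σ₂} := by
  symm
  apply Finset.eq_univ_of_card
  rw [Finset.card_pair (complexEmb_ne hne), AlgHom.card, h2]

lemma trace_eq_add (h2 : Module.finrank ℚ F = 2) (hne : σ₁ ≠ σ₂) (x : F) :
    ((Algebra.trace ℚ F x : ℚ) : ℝ) = σ₁ x + σ₂ x := by
  classical
  have h := trace_eq_sum_embeddings (K := ℚ) (L := F) ℂ (x := x)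
  rw [univ_eq_complexEmb h2 hne, Finset.sum_pair (complexEmb_ne hne)] at h
  simp only [complexEmb_apply, eq_ratCast] at h
  exact_mod_cast h

lemma norm_eq_mul (h2 : Module.finrank ℚ F = 2) (hne : σ₁ ≠ σ₂) (x : F) :
    ((Algebra.norm ℚ x : ℚ) : ℝ) = σ₁ x * σ₂ x := by
  classical
  have h := Algebra.norm_eq_prod_embeddings ℚ ℂ x
  rw [univ_eq_complexEmb h2 hne, Finset.prod_pair (complexEmb_ne hne)] at h
  simp only [complexEmb_apply, eq_ratCast] at h
  exact_mod_cast h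

lemma emb_apply (σ : F →+* ℝ) (a : 𝓞 F) : emb F σ a = σ (algebraMap (𝓞 F) F a) := rfl

lemma emb_injective (σ : F →+* ℝ) : Function.Injective (emb F σ) :=
  σ.injective.comp RingOfIntegers.coe_injective

lemma emb_mul_emb (h2 : Module.finrank ℚ F = 2) (hne : σ₁ ≠ σ₂) (a : 𝓞 F) :
    emb F σ₁ a * emb F σ₂ a = (Algebra.norm ℤ a : ℝ) := by
  rw [emb_apply, emb_apply, ← norm_eq_mul h2 hne, ← Algebra.coe_norm_int]
  simp

lemma one_le_abs_emb_mul (h2 : Module.finrank ℚ F = 2) (hne : σ₁ ≠ σ₂) {a : 𝓞 F} (ha : a ≠ 0) :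
    1 ≤ |emb F σ₁ a| * |emb F σ₂ a| := by
  rw [← abs_mul, emb_mul_emb h2 hne]
  exact_mod_cast Int.one_le_abs (Algebra.norm_ne_zero_iff.mpr ha)

lemma emb_unit_mul (h2 : Module.finrank ℚ F = 2) (hne : σ₁ ≠ σ₂) (ε : (𝓞 F)ˣ)
    (h₁ : 0 < emb F σ₁ ε) (h₂ : 0 < emb F σ₂ ε) : emb F σ₁ ε * emb F σ₂ ε = 1 := by
  have h := emb_mul_emb h2 hne (ε : 𝓞 F)
  have hu : IsUnit (Algebra.norm ℤ (ε : 𝓞 F)) := ε.isUnit.map _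
  rcases Int.isUnit_iff.mp hu with h1 | h1
  · rw [h, h1]; simp
  · rw [h1] at h
    have := mul_pos h₁ h₂
    rw [h] at this
    norm_num at this

/-- There is a unit which is positive in both embeddings and larger than one in the first. -/
lemma exists_unit_gt_one (h2 : Module.finrank ℚ F = 2) (hne : σ₁ ≠ σ₂) :
    ∃ ε : (𝓞 F)ˣ, 1 < emb F σ₁ ε ∧ 0 < emb F σ₂ ε := by
  set v₁ := InfinitePlace.mk (Complex.ofRealHom.comp σ₁)
  set v₂ := InfinitePlace.mk (Complex.ofRealHom.comp σ₂)
  have hv (σ : F →+* ℝ) (x : F) : InfinitePlace.mk (Complex.ofRealHom.comp σ) x = |σ x| := by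
    simp [InfinitePlace.apply]
  have hv12 : v₂ ≠ v₁ := by
    intro h
    rw [InfinitePlace.mk_eq_iff] at h
    apply hne
    ext x
    rcases h with h | h <;> simpa using (congrArg (fun τ => (τ x).re) h).symm
  obtain ⟨u, hu⟩ := Units.dirichletUnitTheorem.exists_unit F v₁
  have hu2 := hu v₂ hv12
  have hneg : |emb F σ₂ u| < 1 := by
    rw [← Real.log_neg_iff (by simpa using (emb_injective σ₂).ne u.ne_zero)]
    simpa [hv, v₂, emb_apply] using hu2
  have hpos (σ : F →+* ℝ) : 0 < emb F σ (u ^ 2 : (𝓞 F)ˣ) := by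
    have : emb F σ u ≠ 0 := by simpa using (emb_injective σ).ne u.ne_zero
    simpa using by positivity
  refine ⟨u ^ 2, ?_, hpos σ₂⟩
  have h1 := emb_unit_mul h2 hne (u ^ 2) (hpos σ₁) (hpos σ₂)
  have h2 : emb F σ₂ (u ^ 2 : (𝓞 F)ˣ) < 1 := by
    simpa [← sq_abs] using pow_lt_one₀ (abs_nonneg _) hneg two_ne_zero
  by_contra! h
  nlinarith [hpos σ₁, hpos σ₂]

end QuadraticField

section RingOfIntegersLattice

variable {F} {σ₁ σ₂ : F →+* ℝ}

open NumberField Matrix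

lemma exists_basis_fin_two (h2 : Module.finrank ℚ F = 2) :
    Nonempty (Module.Basis (Fin 2) ℤ (𝓞 F)) :=
  ⟨Module.finBasisOfFinrankEq ℤ (𝓞 F) (by rw [RingOfIntegers.rank, h2])⟩

/-- The pair of real embeddings of an element. -/
def embVec (σ₁ σ₂ : F →+* ℝ) (x : F) : Fin 2 → ℝ := ![σ₁ x, σ₂ x]

/-- The matrix of real embeddings of an integral basis. -/
def basisMatrix (σ₁ σ₂ : F →+* ℝ) (ω : Module.Basis (Fin 2) ℤ (𝓞 F)) : Matrix (Fin 2) (Fin 2) ℝ :=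
  Matrix.of fun i j => embVec σ₁ σ₂ (ω j : F) i

lemma basisMatrix_mulVec (ω : Module.Basis (Fin 2) ℤ (𝓞 F)) (m : Fin 2 → ℤ) :
    (basisMatrix σ₁ σ₂ ω).mulVec (fun j => (m j : ℝ)) =
      embVec σ₁ σ₂ ((ω.equivFun.symm m : 𝓞 F) : F) := by
  ext i
  rw [Module.Basis.equivFun_symm_apply]
  fin_cases i <;>
  simp [basisMatrix, embVec, Matrix.mulVec, dotProduct, mul_comm]

lemma discr_eq_det_sq (h2 : Module.finrank ℚ F = 2) (hne : σ₁ ≠ σ₂)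
    (ω : Module.Basis (Fin 2) ℤ (𝓞 F)) :
    (NumberField.discr F : ℝ) = (basisMatrix σ₁ σ₂ ω).det ^ 2 := by
  have h : (Algebra.traceMatrix ℤ ω).map (Int.castRingHom ℝ) =
      (basisMatrix σ₁ σ₂ ω)ᵀ * basisMatrix σ₁ σ₂ ω := by
    ext i j
    have h1 := trace_eq_add h2 hne ((ω i * ω j : 𝓞 F) : F)
    rw [← Algebra.coe_trace_int] at h1
    simp only [Rat.cast_intCast] at h1
    simp only [Matrix.map_apply, Algebra.traceMatrix_apply, Algebra.traceForm_apply, eq_intCast, h1]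
    simp [basisMatrix, embVec, Matrix.mul_apply]
  rw [← NumberField.discr_eq_discr F ω, Algebra.discr_def]
  have h3 := congrArg Matrix.det h
  rw [Matrix.det_mul, Matrix.det_transpose] at h3
  rw [sq, ← h3, ← eq_intCast (Int.castRingHom ℝ), RingHom.map_det]
  rfl

lemma sqrt_discr_eq (h2 : Module.finrank ℚ F = 2) (hne : σ₁ ≠ σ₂)
    (ω : Module.Basis (Fin 2) ℤ (𝓞 F)) :
    Real.sqrt (NumberField.discr F) = |(basisMatrix σ₁ σ₂ ω).det| := by
  rw [discr_eq_det_sq h2 hne ω, Real.sqrt_sq_eq_abs]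

lemma basisMatrix_det_ne_zero (h2 : Module.finrank ℚ F = 2) (hne : σ₁ ≠ σ₂)
    (ω : Module.Basis (Fin 2) ℤ (𝓞 F)) : (basisMatrix σ₁ σ₂ ω).det ≠ 0 := by
  intro h
  have := discr_eq_det_sq h2 hne ω
  rw [h] at this
  exact NumberField.discr_ne_zero F (by exact_mod_cast (by simpa using this))

lemma transpose_mulVec_embVec (h2 : Module.finrank ℚ F = 2) (hne : σ₁ ≠ σ₂)
    (ω : Module.Basis (Fin 2) ℤ (𝓞 F)) (x : F) :
    (basisMatrix σ₁ σ₂ ω)ᵀ.mulVec (embVec σ₁ σ₂ x) =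
      fun j => ((Algebra.trace ℚ F (x * ω j) : ℚ) : ℝ) := by
  ext j
  rw [trace_eq_add h2 hne]
  simp [basisMatrix, embVec, Matrix.mulVec, dotProduct, mul_comm]

lemma embVec_eq_mulVec (h2 : Module.finrank ℚ F = 2) (hne : σ₁ ≠ σ₂)
    (ω : Module.Basis (Fin 2) ℤ (𝓞 F)) {B : Matrix (Fin 2) (Fin 2) ℝ}
    (hB : (basisMatrix σ₁ σ₂ ω)ᵀ * B = 1) (x : F) :
    embVec σ₁ σ₂ x = B.mulVec fun j => ((Algebra.trace ℚ F (x * ω j) : ℚ) : ℝ) := by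
  rw [← transpose_mulVec_embVec h2 hne, Matrix.mulVec_mulVec, _root_.mul_eq_one_comm.mp hB,
    Matrix.one_mulVec]

lemma exists_trace_eq (h2 : Module.finrank ℚ F = 2) (hne : σ₁ ≠ σ₂)
    (ω : Module.Basis (Fin 2) ℤ (𝓞 F)) (n : Fin 2 → ℤ) :
    ∃ x : F, ∀ j, Algebra.trace ℚ F (x * ω j) = n j := by
  let φ : F →ₗ[ℚ] (Fin 2 → ℚ) :=
    LinearMap.pi fun j => (Algebra.trace ℚ F).comp (LinearMap.mulRight ℚ (ω j : F))
  have hφ (x : F) (j : Fin 2) : φ x j = Algebra.trace ℚ F (x * ω j) := rfl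
  have hB : (basisMatrix σ₁ σ₂ ω)ᵀ * ((basisMatrix σ₁ σ₂ ω)ᵀ)⁻¹ = 1 := by
    apply Matrix.mul_nonsing_inv
    rw [Matrix.det_transpose]
    exact (basisMatrix_det_ne_zero h2 hne ω).isUnit
  have hinj : Function.Injective φ := by
    rw [injective_iff_map_eq_zero]
    intro x hx
    have h := embVec_eq_mulVec h2 hne ω hB x
    have h0 : (fun j => ((Algebra.trace ℚ F (x * ω j) : ℚ) : ℝ)) = 0 := by
      ext j
      rw [← hφ, hx]
      simp
    rw [h0, Matrix.mulVec_zero] at h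
    have := congrFun h 0
    simpa [embVec] using this
  have hsurj := (LinearMap.injective_iff_surjective_of_finrank_eq_finrank
    (f := φ) (by simp [h2])).mp hinj
  obtain ⟨x, hx⟩ := hsurj (fun j => (n j : ℚ))
  exact ⟨x, fun j => by rw [← hφ, hx]⟩

lemma inInvDiff_of_trace (ω : Module.Basis (Fin 2) ℤ (𝓞 F)) {n : Fin 2 → ℤ} {x : F}
    (hx : ∀ j, Algebra.trace ℚ F (x * ω j) = n j) : InInvDiff F x := by
  intro a
  refine ⟨∑ j, ω.repr a j * n j, ?_⟩
  conv_lhs => rw [← ω.sum_repr a]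
  rw [map_sum, Finset.mul_sum, map_sum, Int.cast_sum]
  simp only [Int.cast_mul]
  refine Finset.sum_congr rfl fun j _ => ?_
  rw [← hx j, zsmul_eq_mul, map_mul (algebraMap (𝓞 F) F), map_intCast, mul_left_comm,
    ← zsmul_eq_mul, map_zsmul, zsmul_eq_mul]

end RingOfIntegersLattice

section LipschitzRingOfIntegers

variable {F} {σ₁ σ₂ : F →+* ℝ}

open NumberField Matrix

/-- The constant in the Lipschitz summation formula over the ring of integers. -/
def lipschitzConst (F : Type) [Field F] [NumberField F] (s : ℂ) : ℂ :=
  ((2 * Real.pi : ℝ) : ℂ) ^ (2 * s) /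
    (Complex.exp (Real.pi * Complex.I * s) * Complex.Gamma s ^ 2 *
      ((Real.sqrt (NumberField.discr F : ℝ) : ℝ) : ℂ))

lemma abs_emb_sub_mul (h2 : Module.finrank ℚ F = 2) (hne : σ₁ ≠ σ₂) (a b : 𝓞 F) (hab : a ≠ b) :
    1 ≤ |emb F σ₁ a - emb F σ₁ b| * |emb F σ₂ a - emb F σ₂ b| := by
  rw [← map_sub, ← map_sub]
  exact one_le_abs_emb_mul h2 hne (sub_ne_zero.mpr hab)

lemma summable_decay_emb (h2 : Module.finrank ℚ F = 2) (hne : σ₁ ≠ σ₂) {τ : ℝ} (hτ : 1 < τ)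
    (x y : ℝ) :
    Summable fun β : 𝓞 F => decay τ (x + emb F σ₁ β) * decay τ (y + emb F σ₂ β) := by
  obtain ⟨C, hC, h⟩ := exists_tsum_decay_le hτ
  have h1 := h (emb F σ₁) (emb F σ₂) (abs_emb_sub_mul h2 hne) x y
  have h3 : ∑' β : 𝓞 F, ENNReal.ofReal
      (decay τ (x + emb F σ₁ β) * decay τ (y + emb F σ₂ β)) ≠ ⊤ := ne_top_of_le_ne_top hC h1
  have h4 := ENNReal.summable_toReal h3
  refine h4.congr fun β => ?_
  rw [ENNReal.toReal_ofReal (mul_nonneg (decay_nonneg _ _) (decay_nonneg _ _))]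

lemma norm_cpow_neg_le_decay {s : ℂ} (hs : 0 < s.re) {w : ℂ} (hw : 0 < w.im) (x : ℝ) :
    ‖(w + x) ^ (-s)‖ ≤ Real.exp (Real.pi * |s.im|) * (min 1 w.im) ^ (-s.re) *
      decay s.re (w.re + x) := by
  have him : (w + x).im = w.im := by simp
  have hle : min 1 w.im ≤ ‖w + x‖ := (min_le_right _ _).trans
    (by rw [← him]; exact (le_abs_self _).trans (Complex.abs_im_le_norm _))
  have hne : w + x ≠ 0 := fun h => by rw [h] at him; simp at him; linarith
  refine (norm_cpow_neg_le s hne).trans ?_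
  rw [mul_assoc]
  gcongr
  simpa using norm_rpow_neg_le_decay hs (lt_min one_pos hw) (min_le_left _ _) hle

lemma summable_emb_cpow (h2 : Module.finrank ℚ F = 2) (hne : σ₁ ≠ σ₂) {s : ℂ} (hs : 1 < s.re)
    {w₁ w₂ : ℂ} (h₁ : 0 < w₁.im) (h₂ : 0 < w₂.im) :
    Summable fun β : 𝓞 F => (w₁ + (emb F σ₁ β : ℝ)) ^ (-s) * (w₂ + (emb F σ₂ β : ℝ)) ^ (-s) := by
  have h0 : 0 < s.re := by linarith
  refine Summable.of_norm_bounded (((summable_decay_emb h2 hne hs w₁.re w₂.re)).mul_left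
    ((Real.exp (Real.pi * |s.im|) * (min 1 w₁.im) ^ (-s.re)) *
      (Real.exp (Real.pi * |s.im|) * (min 1 w₂.im) ^ (-s.re)))) fun β => ?_
  rw [norm_mul]
  refine (mul_le_mul (norm_cpow_neg_le_decay h0 h₁ _) (norm_cpow_neg_le_decay h0 h₂ _)
    (norm_nonneg _) ?_).trans_eq (by ring)
  exact (norm_nonneg _).trans (norm_cpow_neg_le_decay h0 h₁ _)

lemma lipschitz_ringOfIntegers (h2 : Module.finrank ℚ F = 2) (hne : σ₁ ≠ σ₂) {s : ℂ}
    (hs : 1 < s.re) {w₁ w₂ : ℂ} (h₁ : 0 < w₁.im) (h₂ : 0 < w₂.im) :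
    (Summable fun ξ : InvDiffPos F σ₁ σ₂ => ((σ₁ ξ.1 * σ₂ ξ.1 : ℝ) : ℂ) ^ (s - 1) *
      cexp (2 * Real.pi * I * (((σ₁ ξ.1 : ℝ) : ℂ) * w₁ + ((σ₂ ξ.1 : ℝ) : ℂ) * w₂))) ∧
    ∑' β : 𝓞 F, (w₁ + (emb F σ₁ β : ℝ)) ^ (-s) * (w₂ + (emb F σ₂ β : ℝ)) ^ (-s) =
      lipschitzConst F s * ∑' ξ : InvDiffPos F σ₁ σ₂, ((σ₁ ξ.1 * σ₂ ξ.1 : ℝ) : ℂ) ^ (s - 1) *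
        cexp (2 * Real.pi * I * (((σ₁ ξ.1 : ℝ) : ℂ) * w₁ + ((σ₂ ξ.1 : ℝ) : ℂ) * w₂)) := by
  obtain ⟨ω⟩ := exists_basis_fin_two h2
  set M := basisMatrix σ₁ σ₂ ω with hM
  have hdet : M.det ≠ 0 := basisMatrix_det_ne_zero h2 hne ω
  have hB : Mᵀ * (Mᵀ)⁻¹ = 1 := by
    apply Matrix.mul_nonsing_inv
    rw [Matrix.det_transpose]
    exact hdet.isUnit
  set B := (Mᵀ)⁻¹
  let w : Fin 2 → ℂ := ![w₁, w₂]
  have hw : ∀ i, 0 < (w i).im := by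
    intro i; fin_cases i
    · exact h₁
    · exact h₂
  have hfun : (fun β : 𝓞 F => (w₁ + (emb F σ₁ β : ℝ)) ^ (-s) * (w₂ + (emb F σ₂ β : ℝ)) ^ (-s)) ∘
      ω.equivFun.symm = fun m => ∏ i, (w i + M.mulVec (fun j => (m j : ℝ)) i) ^ (-s) := by
    ext m
    rw [hM, basisMatrix_mulVec]
    simp [w, embVec, emb_apply]
  have hsum := (ω.equivFun.symm.toEquiv.summable_iff).mpr (summable_emb_cpow h2 hne hs h₁ h₂)
  have htsum := ω.equivFun.symm.toEquiv.tsum_eq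
    (fun β : 𝓞 F => (w₁ + (emb F σ₁ β : ℝ)) ^ (-s) * (w₂ + (emb F σ₂ β : ℝ)) ^ (-s))
  obtain ⟨hS, hT⟩ := lipschitz_lattice hB hs hw (hfun ▸ hsum)
  -- coordinates of an element of the inverse different
  have hcoord (ξ : InvDiffPos F σ₁ σ₂) : ∃ n : Fin 2 → ℤ, ∀ j,
      Algebra.trace ℚ F (ξ.1 * ω j) = n j := by
    choose n hn using fun j => ξ.2.1 (ω j)
    exact ⟨n, hn⟩
  choose n hn using hcoord
  have hvec (x : F) (m : Fin 2 → ℤ) (hm : ∀ j, Algebra.trace ℚ F (x * ω j) = m j) :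
      B.mulVec (fun j => (m j : ℝ)) = embVec σ₁ σ₂ x := by
    rw [embVec_eq_mulVec h2 hne ω hB]
    simp [hm]
  have hninj : Function.Injective n := by
    intro ξ η h
    have h1 := hvec ξ.1 _ (hn ξ)
    rw [h, hvec η.1 _ (hn η)] at h1
    have := congrFun h1 0
    exact Subtype.ext (σ₁.injective (by simpa [embVec] using this.symm))
  have hterm (ξ : InvDiffPos F σ₁ σ₂) :
      ∏ i, gammaKernel s (w i) (B.mulVec (fun j => (n ξ j : ℝ)) i) =
      ((σ₁ ξ.1 * σ₂ ξ.1 : ℝ) : ℂ) ^ (s - 1) *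
        cexp (2 * Real.pi * I * (((σ₁ ξ.1 : ℝ) : ℂ) * w₁ + ((σ₂ ξ.1 : ℝ) : ℂ) * w₂)) := by
    rw [hvec ξ.1 _ (hn ξ)]
    simp only [Fin.prod_univ_two, embVec, w, Matrix.cons_val_zero, Matrix.cons_val_one]
    rw [gammaKernel_of_pos _ ξ.2.2.1, gammaKernel_of_pos _ ξ.2.2.2, Complex.ofReal_mul,
      Complex.mul_cpow_ofReal_nonneg ξ.2.2.1.le ξ.2.2.2.le, mul_add, Complex.exp_add]
    ring
  have hsupp : (Function.support fun m : Fin 2 → ℤ =>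
      ∏ i, gammaKernel s (w i) (B.mulVec (fun j => (m j : ℝ)) i)) ⊆ Set.range n := by
    intro m hm
    obtain ⟨x, hx⟩ := exists_trace_eq h2 hne ω m
    have hpos (i : Fin 2) : 0 < embVec σ₁ σ₂ x i := by
      by_contra! h
      apply hm
      apply Finset.prod_eq_zero (Finset.mem_univ i)
      rw [hvec x m hx]
      exact gammaKernel_of_nonpos hs _ h
    refine ⟨⟨x, inInvDiff_of_trace ω hx, hpos 0, hpos 1⟩, ?_⟩
    ext j
    exact_mod_cast (hn ⟨x, _⟩ j).symm.trans (hx j)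
  have hts := hninj.tsum_eq hsupp
  simp only [hterm] at hts
  refine ⟨?_, ?_⟩
  · have := hS.comp_injective hninj
    exact this.congr hterm
  · rw [hts, hT, ← htsum]
    have : (fun m => (fun β : 𝓞 F => (w₁ + (emb F σ₁ β : ℝ)) ^ (-s) *
        (w₂ + (emb F σ₂ β : ℝ)) ^ (-s)) (ω.equivFun.symm.toEquiv m)) =
        fun m => ∏ i, (w i + M.mulVec (fun j => (m j : ℝ)) i) ^ (-s) := hfun
    rw [this, lipschitzConst, sqrt_discr_eq h2 hne ω, ← hM]
    have hd : ((|M.det| : ℝ) : ℂ) ≠ 0 := by exact_mod_cast abs_ne_zero.mpr hdet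
    have hG : Complex.Gamma s ≠ 0 := Complex.Gamma_ne_zero_of_re_pos (by linarith)
    have hpi : ((2 * Real.pi : ℝ) : ℂ) ^ (2 * s) ≠ 0 := by
      rw [Ne, Complex.cpow_eq_zero_iff]
      have : (2 * Real.pi : ℝ) ≠ 0 := by positivity
      exact fun h => this (by exact_mod_cast h.1)
    have he := Complex.exp_ne_zero (Real.pi * I * s)
    field_simp

lemma lipschitzConst_ne_zero {s : ℂ} (hs : 1 < s.re) (h2 : Module.finrank ℚ F = 2)
    (hne : σ₁ ≠ σ₂) : lipschitzConst F s ≠ 0 := by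
  obtain ⟨ω⟩ := exists_basis_fin_two h2
  have hdet := basisMatrix_det_ne_zero h2 hne ω
  rw [lipschitzConst, sqrt_discr_eq h2 hne ω]
  have hd : ((|(basisMatrix σ₁ σ₂ ω).det| : ℝ) : ℂ) ≠ 0 := by
    exact_mod_cast abs_ne_zero.mpr hdet
  have hG : Complex.Gamma s ≠ 0 := Complex.Gamma_ne_zero_of_re_pos (by linarith)
  have hpi : ((2 * Real.pi : ℝ) : ℂ) ^ (2 * s) ≠ 0 := by
    rw [Ne, Complex.cpow_eq_zero_iff]
    have : (2 * Real.pi : ℝ) ≠ 0 := by positivity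
    exact fun h => this (by exact_mod_cast h.1)
  have he := Complex.exp_ne_zero (Real.pi * I * s)
  exact div_ne_zero hpi (mul_ne_zero (mul_ne_zero he (pow_ne_zero 2 hG)) hd)

end LipschitzRingOfIntegers

section MoebiusAction

lemma jfac_ne_zero {g : Matrix (Fin 2) (Fin 2) ℝ} (hg : g.det = 1) {z : ℂ} (hz : 0 < z.im) :
    jfac g z ≠ 0 := by
  intro h
  have him := congrArg Complex.im h
  have hre := congrArg Complex.re h
  simp only [jfac, Complex.add_im, Complex.mul_im, Complex.ofReal_re, Complex.ofReal_im, zero_mul,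
    add_zero, Complex.zero_im, mul_eq_zero, hz.ne', or_false] at him
  simp only [jfac, Complex.add_re, Complex.mul_re, Complex.ofReal_re, Complex.ofReal_im, zero_mul,
    sub_zero, Complex.zero_re, him, zero_add] at hre
  rw [Matrix.det_fin_two, him, hre] at hg
  simp at hg

lemma moebius_im {g : Matrix (Fin 2) (Fin 2) ℝ} (hg : g.det = 1) (z : ℂ) :
    (moebius g z).im = z.im / ‖jfac g z‖ ^ 2 := by
  rw [Matrix.det_fin_two] at hg
  rw [moebius, Complex.div_im, ← jfac, ← Complex.normSq_eq_norm_sq, ← sub_div]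
  congr 1
  simp only [jfac, Complex.add_im, Complex.mul_im, Complex.add_re, Complex.mul_re,
    Complex.ofReal_re, Complex.ofReal_im]
  linear_combination z.im * hg

lemma moebius_im_pos {g : Matrix (Fin 2) (Fin 2) ℝ} (hg : g.det = 1) {z : ℂ} (hz : 0 < z.im) :
    0 < (moebius g z).im := by
  rw [moebius_im hg]
  have := norm_pos_iff.mpr (jfac_ne_zero hg hz)
  positivity

lemma jfac_mul (p : Matrix (Fin 2) (Fin 2) ℝ) {g : Matrix (Fin 2) (Fin 2) ℝ} {z : ℂ}
    (h : jfac g z ≠ 0) : jfac (p * g) z = jfac p (moebius g z) * jfac g z := by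
  simp only [moebius, jfac, Matrix.mul_apply, Fin.sum_univ_two] at h ⊢
  push_cast
  field_simp
  ring

lemma moebius_mul (p : Matrix (Fin 2) (Fin 2) ℝ) {g : Matrix (Fin 2) (Fin 2) ℝ} {z : ℂ}
    (h : jfac g z ≠ 0) : moebius (p * g) z = moebius p (moebius g z) := by
  have key : ((p 0 0 : ℝ) : ℂ) * moebius g z + ((p 0 1 : ℝ) : ℂ) =
      ((((p * g) 0 0 : ℝ) : ℂ) * z + (((p * g) 0 1 : ℝ) : ℂ)) / jfac g z := by
    rw [eq_div_iff h, moebius, ← jfac, add_mul, mul_assoc, div_mul_cancel₀ _ h, jfac]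
    simp only [Matrix.mul_apply, Fin.sum_univ_two]
    push_cast
    ring
  have h2 : jfac p (moebius g z) = jfac (p * g) z / jfac g z := by
    rw [jfac_mul p h, mul_div_cancel_right₀ _ h]
  rw [moebius, moebius.eq_1 p, ← jfac, ← jfac, key, h2, div_div_div_cancel_right₀ h]

end MoebiusAction

section ModularGroup

variable {F} {σ₁ σ₂ : F →+* ℝ}

open NumberField

lemma mat_mul (σ : F →+* ℝ) (γ δ : SL2O F) : mat F σ (γ * δ) = mat F σ γ * mat F σ δ := by
  simp [mat, Matrix.map_mul]

lemma mat_det (σ : F →+* ℝ) (γ : SL2O F) : (mat F σ γ).det = 1 := by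
  have := RingHom.map_det (emb F σ) (γ : Matrix (Fin 2) (Fin 2) (𝓞 F))
  rw [γ.det_coe, map_one] at this
  exact this.symm

lemma jfac_mat_ne_zero (σ : F →+* ℝ) (γ : SL2O F) {z : ℂ} (hz : 0 < z.im) :
    jfac (mat F σ γ) z ≠ 0 := jfac_ne_zero (mat_det σ γ) hz

lemma moebius_mat_im_pos (σ : F →+* ℝ) (γ : SL2O F) {z : ℂ} (hz : 0 < z.im) :
    0 < (moebius (mat F σ γ) z).im := moebius_im_pos (mat_det σ γ) hz

lemma jfac_mat_mul (σ : F →+* ℝ) (p γ : SL2O F) {z : ℂ} (hz : 0 < z.im) :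
    jfac (mat F σ (p * γ)) z = jfac (mat F σ p) (moebius (mat F σ γ) z) * jfac (mat F σ γ) z := by
  rw [mat_mul, jfac_mul _ (jfac_mat_ne_zero σ γ hz)]

lemma moebius_mat_mul (σ : F →+* ℝ) (p γ : SL2O F) {z : ℂ} (hz : 0 < z.im) :
    moebius (mat F σ (p * γ)) z = moebius (mat F σ p) (moebius (mat F σ γ) z) := by
  rw [mat_mul, moebius_mul _ (jfac_mat_ne_zero σ γ hz)]

/-- The translation matrix `(1, β; 0, 1)`. -/
def transElt (β : 𝓞 F) : SL2O F := ⟨!![1, β; 0, 1], by simp⟩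

/-- The diagonal matrix `diag(ε, ε⁻¹)`. -/
def diagElt (ε : (𝓞 F)ˣ) : SL2O F := ⟨!![(ε : 𝓞 F), 0; 0, ((ε⁻¹ : (𝓞 F)ˣ) : 𝓞 F)], by simp⟩

/-- The inversion matrix `(0, -1; 1, 0)`. -/
def invElt (F : Type) [Field F] [NumberField F] : SL2O F := ⟨!![0, -1; 1, 0], by simp⟩

/-- Units which are positive in both embeddings. -/
def PosUnit (σ₁ σ₂ : F →+* ℝ) (ε : (𝓞 F)ˣ) : Prop := 0 < emb F σ₁ ε ∧ 0 < emb F σ₂ ε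

lemma isInA_iff {a : SL2O F} :
    IsInA F σ₁ σ₂ a ↔ ∃ ε : (𝓞 F)ˣ, PosUnit σ₁ σ₂ ε ∧ a = diagElt ε :=
  exists_congr fun _ => and_congr Iff.rfl ⟨fun h => Subtype.ext h, fun h => by rw [h]; rfl⟩

lemma jfac_transElt_mul (σ : F →+* ℝ) (γ : SL2O F) {z : ℂ} (hz : 0 < z.im)
    (β : 𝓞 F) :
    jfac (mat F σ (transElt β * γ)) z = jfac (mat F σ γ) z := by
  rw [jfac_mat_mul σ _ γ hz]
  simp [jfac, mat, transElt]

lemma moebius_transElt_mul (σ : F →+* ℝ) (γ : SL2O F) {z : ℂ} (hz : 0 < z.im)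
    (β : 𝓞 F) :
    moebius (mat F σ (transElt β * γ)) z = moebius (mat F σ γ) z + (emb F σ β : ℝ) := by
  rw [moebius_mat_mul σ _ γ hz, moebius.eq_1 (mat F σ (transElt β))]
  simp [mat, transElt]

lemma jfac_diagElt_mul (σ : F →+* ℝ) (γ : SL2O F) {z : ℂ} (hz : 0 < z.im)
    (ε : (𝓞 F)ˣ) :
    jfac (mat F σ (diagElt ε * γ)) z =
      (emb F σ (ε⁻¹ : (𝓞 F)ˣ) : ℝ) * jfac (mat F σ γ) z := by
  rw [jfac_mat_mul σ _ γ hz]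
  simp [jfac, mat, diagElt]

lemma moebius_diagElt_mul (σ : F →+* ℝ) (γ : SL2O F) {z : ℂ} (hz : 0 < z.im)
    (ε : (𝓞 F)ˣ) :
    moebius (mat F σ (diagElt ε * γ)) z =
      ((emb F σ ε ^ 2 : ℝ) : ℂ) * moebius (mat F σ γ) z := by
  rw [moebius_mat_mul σ _ γ hz, moebius.eq_1 (mat F σ (diagElt ε))]
  have h : emb F σ ε * emb F σ (ε⁻¹ : (𝓞 F)ˣ) = 1 := by rw [← map_mul]; simp
  have h' : ((emb F σ ε : ℝ) : ℂ) * ((emb F σ (ε⁻¹ : (𝓞 F)ˣ) : ℝ) : ℂ) = 1 := by exact_mod_cast h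
  have hne : ((emb F σ (ε⁻¹ : (𝓞 F)ˣ) : ℝ) : ℂ) ≠ 0 := right_ne_zero_of_mul_eq_one h'
  have h00 : mat F σ (diagElt ε) 0 0 = emb F σ ε := rfl
  have h01 : mat F σ (diagElt ε) 0 1 = 0 := map_zero (emb F σ)
  have h10 : mat F σ (diagElt ε) 1 0 = 0 := map_zero (emb F σ)
  have h11 : mat F σ (diagElt ε) 1 1 = emb F σ (ε⁻¹ : (𝓞 F)ˣ) := rfl
  rw [h00, h01, h10, h11]
  push_cast
  rw [zero_mul, zero_add, add_zero]
  rw [div_eq_iff hne]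
  linear_combination (-((emb F σ ε : ℝ) : ℂ)) * moebius (mat F σ γ) z * h'

lemma jfac_invElt_mul (σ : F →+* ℝ) (γ : SL2O F) {z : ℂ} (hz : 0 < z.im) :
    jfac (mat F σ (invElt F * γ)) z = moebius (mat F σ γ) z * jfac (mat F σ γ) z := by
  rw [jfac_mat_mul σ _ γ hz]
  simp [jfac, mat, invElt]

lemma moebius_invElt_mul (σ : F →+* ℝ) (γ : SL2O F) {z : ℂ} (hz : 0 < z.im) :
    moebius (mat F σ (invElt F * γ)) z = -(moebius (mat F σ γ) z)⁻¹ := by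
  rw [moebius_mat_mul σ _ γ hz, moebius.eq_1 (mat F σ (invElt F))]
  simp [mat, invElt, neg_div]

lemma PosUnit.emb_mul (h2 : Module.finrank ℚ F = 2) (hne : σ₁ ≠ σ₂) {ε : (𝓞 F)ˣ}
    (h : PosUnit σ₁ σ₂ ε) : emb F σ₁ ε * emb F σ₂ ε = 1 :=
  emb_unit_mul h2 hne ε h.1 h.2

lemma emb_unit_inv (σ : F →+* ℝ) (ε : (𝓞 F)ˣ) :
    emb F σ (ε⁻¹ : (𝓞 F)ˣ) = (emb F σ ε)⁻¹ := by
  apply eq_inv_of_mul_eq_one_left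
  rw [← map_mul]; simp

lemma PosUnit.inv {ε : (𝓞 F)ˣ} (h : PosUnit σ₁ σ₂ ε) : PosUnit σ₁ σ₂ ε⁻¹ := by
  simp only [PosUnit, emb_unit_inv, inv_pos]
  exact h

lemma PosUnit.mul {ε η : (𝓞 F)ˣ} (h : PosUnit σ₁ σ₂ ε) (h' : PosUnit σ₁ σ₂ η) :
    PosUnit σ₁ σ₂ (ε * η) := by
  simp only [PosUnit, Units.val_mul, map_mul]
  exact ⟨mul_pos h.1 h'.1, mul_pos h.2 h'.2⟩

lemma cohenSummand_diagElt_mul (h2 : Module.finrank ℚ F = 2) (hne : σ₁ ≠ σ₂) (k : ℕ) (s : ℂ)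
    {z₁ z₂ : ℂ} (hz₁ : 0 < z₁.im) (hz₂ : 0 < z₂.im) {ε : (𝓞 F)ˣ} (h : PosUnit σ₁ σ₂ ε)
    (γ : SL2O F) : cohenSummand F σ₁ σ₂ k s z₁ z₂ (diagElt ε * γ) =
      cohenSummand F σ₁ σ₂ k s z₁ z₂ γ := by
  have hm := h.emb_mul h2 hne
  have hm' := h.inv.emb_mul h2 hne
  have e₁ := h.1
  have e₂ := h.2
  rw [cohenSummand, cohenSummand, moebius_diagElt_mul _ _ hz₁, moebius_diagElt_mul _ _ hz₂,
    jfac_diagElt_mul _ _ hz₁, jfac_diagElt_mul _ _ hz₂]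
  have hc (r : ℝ) (hr : 0 < r) (w : ℂ) (hw : 0 < w.im) :
      ((r : ℂ) * w) ^ (-s) = (r : ℂ) ^ (-s) * w ^ (-s) := by
    have hw0 : w ≠ 0 := fun h => by simp [h] at hw
    have hr0 : (r : ℂ) ≠ 0 := by exact_mod_cast hr.ne'
    rw [Complex.cpow_def_of_ne_zero (mul_ne_zero hr0 hw0), Complex.cpow_def_of_ne_zero hr0,
      Complex.cpow_def_of_ne_zero hw0, Complex.log_ofReal_mul hr hw0, Complex.ofReal_log hr.le,
      add_mul, Complex.exp_add]
  rw [hc _ (by positivity) _ (moebius_mat_im_pos _ _ hz₁),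
    hc _ (by positivity) _ (moebius_mat_im_pos _ _ hz₂), mul_zpow, mul_zpow]
  have h1 : ((emb F σ₁ ε ^ 2 : ℝ) : ℂ) ^ (-s) * ((emb F σ₂ ε ^ 2 : ℝ) : ℂ) ^ (-s) = 1 := by
    rw [← Complex.mul_cpow_ofReal_nonneg (by positivity) (by positivity), ← Complex.ofReal_mul,
      ← mul_pow, hm]
    simp
  have h2 : ((emb F σ₁ (ε⁻¹ : (𝓞 F)ˣ) : ℝ) : ℂ) ^ (-(k : ℤ)) *
      ((emb F σ₂ (ε⁻¹ : (𝓞 F)ˣ) : ℝ) : ℂ) ^ (-(k : ℤ)) = 1 := by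
    rw [← mul_zpow, ← Complex.ofReal_mul, hm']
    simp
  rw [mul_mul_mul_comm (_ ^ (-s)), h1, one_mul, mul_mul_mul_comm (_ ^ (-(k : ℤ))), h2, one_mul]

end ModularGroup

section Normalization

variable {F} {σ₁ σ₂ : F →+* ℝ}

open NumberField

/-- The two automorphy factors of `γ` have comparable absolute values. -/
def Balanced (σ₁ σ₂ : F →+* ℝ) (R : ℝ) (z₁ z₂ : ℂ) (γ : SL2O F) : Prop :=
  ‖jfac (mat F σ₂ γ) z₂‖ ≤ ‖jfac (mat F σ₁ γ) z₁‖ ∧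
    ‖jfac (mat F σ₁ γ) z₁‖ ≤ R * ‖jfac (mat F σ₂ γ) z₂‖

lemma emb_unit_zpow (σ : F →+* ℝ) (ε : (𝓞 F)ˣ) (n : ℤ) :
    emb F σ (ε ^ n : (𝓞 F)ˣ) = emb F σ ε ^ n := by
  have h := congrArg Units.val (map_zpow (Units.map (emb F σ).toMonoidHom) ε n)
  rw [Units.val_zpow_eq_zpow_val] at h
  exact h

lemma norm_jfac_diagElt_mul {σ : F →+* ℝ} {ε : (𝓞 F)ˣ} (h : 0 < emb F σ ε) (γ : SL2O F) {z : ℂ}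
    (hz : 0 < z.im) :
    ‖jfac (mat F σ (diagElt ε * γ)) z‖ = (emb F σ ε)⁻¹ * ‖jfac (mat F σ γ) z‖ := by
  rw [jfac_diagElt_mul σ γ hz, norm_mul, Complex.norm_real, emb_unit_inv, Real.norm_of_nonneg]
  exact inv_nonneg.mpr h.le

/-- Every orbit of the totally positive diagonal units contains a balanced matrix. -/
lemma exists_balanced (h2 : Module.finrank ℚ F = 2) (hne : σ₁ ≠ σ₂) :
    ∃ R : ℝ, 1 ≤ R ∧ ∀ {z₁ z₂ : ℂ}, 0 < z₁.im → 0 < z₂.im → ∀ γ : SL2O F,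
      ∃ ε : (𝓞 F)ˣ, PosUnit σ₁ σ₂ ε ∧ Balanced σ₁ σ₂ R z₁ z₂ (diagElt ε * γ) := by
  obtain ⟨ε, h₁, h₂⟩ := exists_unit_gt_one h2 hne
  have hmul := emb_unit_mul h2 hne ε (by linarith) h₂
  have hρ : 0 < emb F σ₁ ε := by linarith
  refine ⟨emb F σ₁ ε ^ 2, one_le_pow₀ h₁.le, fun {z₁ z₂} hz₁ hz₂ γ => ?_⟩
  have hj₁ := norm_pos_iff.mpr (jfac_mat_ne_zero σ₁ γ hz₁)
  have hj₂ := norm_pos_iff.mpr (jfac_mat_ne_zero σ₂ γ hz₂)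
  obtain ⟨n, hn1, hn2⟩ := exists_mem_Ico_zpow (div_pos hj₁ hj₂) (one_lt_pow₀ h₁ two_ne_zero)
  have hp : PosUnit σ₁ σ₂ (ε ^ n) := by
    simp only [PosUnit, emb_unit_zpow]
    exact ⟨zpow_pos hρ n, zpow_pos h₂ n⟩
  refine ⟨ε ^ n, hp, ?_⟩
  have e2 : emb F σ₂ ε = (emb F σ₁ ε)⁻¹ := eq_inv_of_mul_eq_one_right hmul
  rw [Balanced, norm_jfac_diagElt_mul hp.1 γ hz₁, norm_jfac_diagElt_mul hp.2 γ hz₂, emb_unit_zpow,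
    emb_unit_zpow, e2]
  set ρ := emb F σ₁ ε
  rw [le_div_iff₀ hj₂] at hn1
  rw [div_lt_iff₀ hj₂, zpow_add_one₀ (by positivity)] at hn2
  have hsq : (ρ ^ 2) ^ n = ρ ^ n * ρ ^ n := by rw [sq, mul_zpow]
  rw [hsq] at hn1 hn2
  have hx : 0 < ρ ^ n := zpow_pos hρ n
  rw [inv_zpow, inv_inv]
  set x := ρ ^ n
  constructor
  · rw [le_inv_mul_iff₀ hx]
    linarith
  · rw [inv_mul_le_iff₀ hx]
    linarith

end Normalization

section BottomRow

lemma exists_lower_bound_jfac {z : ℂ} (hz : 0 < z.im) :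
    ∃ δ : ℝ, 0 < δ ∧ ∀ c d : ℝ, δ * |c| ≤ ‖(c : ℂ) * z + d‖ ∧ δ * |d| ≤ ‖(c : ℂ) * z + d‖ := by
  refine ⟨min z.im (z.im / (z.im + ‖z‖)), by positivity, fun c d => ?_⟩
  have hc : z.im * |c| ≤ ‖(c : ℂ) * z + d‖ := by
    have := Complex.abs_im_le_norm ((c : ℂ) * z + d)
    simpa [abs_mul, abs_of_pos hz, mul_comm] using this
  refine ⟨le_trans (by gcongr; exact min_le_left _ _) hc, ?_⟩
  refine le_trans (mul_le_mul_of_nonneg_right (min_le_right _ _) (abs_nonneg d)) ?_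
  have hd : |d| ≤ ‖(c : ℂ) * z + d‖ + |c| * ‖z‖ := by
    have := norm_sub_le ((c : ℂ) * z + d) ((c : ℂ) * z)
    simpa using this
  rw [div_mul_eq_mul_div, div_le_iff₀ (by positivity)]
  nlinarith [norm_nonneg z]

variable {F} {σ₁ σ₂ : F →+* ℝ}

open NumberField

/-- The bottom row of a matrix. -/
def bottomRow (γ : SL2O F) : 𝓞 F × 𝓞 F :=
  ((γ : Matrix (Fin 2) (Fin 2) (𝓞 F)) 1 0, (γ : Matrix (Fin 2) (Fin 2) (𝓞 F)) 1 1)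

lemma jfac_mat_eq (σ : F →+* ℝ) (γ : SL2O F) (z : ℂ) :
    jfac (mat F σ γ) z =
      ((emb F σ (bottomRow γ).1 : ℝ) : ℂ) * z + ((emb F σ (bottomRow γ).2 : ℝ) : ℂ) := rfl

lemma exists_transElt_of_bottomRow_eq {γ δ : SL2O F} (h : bottomRow γ = bottomRow δ) :
    ∃ β : 𝓞 F, γ = transElt β * δ := by
  simp only [bottomRow, Prod.mk.injEq] at h
  obtain ⟨h0, h1⟩ := h
  have hγ := γ.det_coe
  have hδ := δ.det_coe
  rw [Matrix.det_fin_two] at hγ hδ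
  refine ⟨(γ : Matrix (Fin 2) (Fin 2) (𝓞 F)) 0 1 * (δ : Matrix (Fin 2) (Fin 2) (𝓞 F)) 0 0 -
    (γ : Matrix (Fin 2) (Fin 2) (𝓞 F)) 0 0 * (δ : Matrix (Fin 2) (Fin 2) (𝓞 F)) 0 1, ?_⟩
  rw [h0, h1] at hγ
  have e0 : (γ : Matrix (Fin 2) (Fin 2) (𝓞 F)) 0 0 =
      (δ : Matrix (Fin 2) (Fin 2) (𝓞 F)) 0 0 +
        ((γ : Matrix (Fin 2) (Fin 2) (𝓞 F)) 0 1 * (δ : Matrix (Fin 2) (Fin 2) (𝓞 F)) 0 0 -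
          (γ : Matrix (Fin 2) (Fin 2) (𝓞 F)) 0 0 * (δ : Matrix (Fin 2) (Fin 2) (𝓞 F)) 0 1) *
        (δ : Matrix (Fin 2) (Fin 2) (𝓞 F)) 1 0 := by
    linear_combination (δ : Matrix (Fin 2) (Fin 2) (𝓞 F)) 0 0 * hγ -
      (γ : Matrix (Fin 2) (Fin 2) (𝓞 F)) 0 0 * hδ
  have e1 : (γ : Matrix (Fin 2) (Fin 2) (𝓞 F)) 0 1 =
      (δ : Matrix (Fin 2) (Fin 2) (𝓞 F)) 0 1 +
        ((γ : Matrix (Fin 2) (Fin 2) (𝓞 F)) 0 1 * (δ : Matrix (Fin 2) (Fin 2) (𝓞 F)) 0 0 -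
          (γ : Matrix (Fin 2) (Fin 2) (𝓞 F)) 0 0 * (δ : Matrix (Fin 2) (Fin 2) (𝓞 F)) 0 1) *
        (δ : Matrix (Fin 2) (Fin 2) (𝓞 F)) 1 1 := by
    linear_combination (δ : Matrix (Fin 2) (Fin 2) (𝓞 F)) 0 1 * hγ -
      (γ : Matrix (Fin 2) (Fin 2) (𝓞 F)) 0 1 * hδ
  apply Subtype.ext
  refine Matrix.ext fun i j => ?_
  rw [Matrix.SpecialLinearGroup.coe_mul, Matrix.mul_apply, Fin.sum_univ_two]
  fin_cases i <;> fin_cases j <;> simp only [transElt, Matrix.of_apply,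
    Matrix.cons_val', Matrix.cons_val_zero, Matrix.cons_val_one, Matrix.cons_val_fin_one,
    one_mul, zero_mul, zero_add, Fin.zero_eta, Fin.mk_one]
  · exact e0
  · exact e1
  · exact h0
  · exact h1

/-- Lower bounds for the automorphy factors of balanced matrices. -/
lemma exists_lower_bound_of_balanced (h2 : Module.finrank ℚ F = 2) (hne : σ₁ ≠ σ₂) {R : ℝ}
    (hR : 1 ≤ R) {z₁ z₂ : ℂ} (hz₁ : 0 < z₁.im) (hz₂ : 0 < z₂.im) :
    ∃ κ : ℝ, 0 < κ ∧ κ ≤ 1 ∧ ∀ γ : SL2O F, Balanced σ₁ σ₂ R z₁ z₂ γ →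
      (κ * max 1 |emb F σ₁ (bottomRow γ).1| ≤ ‖jfac (mat F σ₁ γ) z₁‖ ∧
        κ * max 1 |emb F σ₁ (bottomRow γ).2| ≤ ‖jfac (mat F σ₁ γ) z₁‖) ∧
      κ * max 1 |emb F σ₂ (bottomRow γ).1| ≤ ‖jfac (mat F σ₂ γ) z₂‖ ∧
        κ * max 1 |emb F σ₂ (bottomRow γ).2| ≤ ‖jfac (mat F σ₂ γ) z₂‖ := by
  obtain ⟨δ₁, hδ₁, H₁⟩ := exists_lower_bound_jfac hz₁
  obtain ⟨δ₂, hδ₂, H₂⟩ := exists_lower_bound_jfac hz₂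
  set δ := min 1 (min δ₁ δ₂)
  have hδ : 0 < δ := by positivity
  have hδ1 : δ ≤ δ₁ := (min_le_right _ _).trans (min_le_left _ _)
  have hδ2 : δ ≤ δ₂ := (min_le_right _ _).trans (min_le_right _ _)
  have hκδ : δ / R ≤ δ := div_le_self hδ.le hR
  refine ⟨δ / R, by positivity, hκδ.trans (min_le_left _ _), fun γ hγ => ?_⟩
  obtain ⟨hc₁, hd₁⟩ := H₁ (emb F σ₁ (bottomRow γ).1) (emb F σ₁ (bottomRow γ).2)
  obtain ⟨hc₂, hd₂⟩ := H₂ (emb F σ₂ (bottomRow γ).1) (emb F σ₂ (bottomRow γ).2)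
  rw [← jfac_mat_eq] at hc₁ hd₁ hc₂ hd₂
  obtain ⟨hb1, hb2⟩ := hγ
  have hJ : δ ^ 2 ≤ ‖jfac (mat F σ₁ γ) z₁‖ * ‖jfac (mat F σ₂ γ) z₂‖ := by
    have key (a : 𝓞 F) (ha : a ≠ 0) (h1 : δ₁ * |emb F σ₁ a| ≤ ‖jfac (mat F σ₁ γ) z₁‖)
        (h2' : δ₂ * |emb F σ₂ a| ≤ ‖jfac (mat F σ₂ γ) z₂‖) :
        δ ^ 2 ≤ ‖jfac (mat F σ₁ γ) z₁‖ * ‖jfac (mat F σ₂ γ) z₂‖ := by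
      calc δ ^ 2 = (δ * δ) * 1 := by ring
        _ ≤ (δ₁ * δ₂) * (|emb F σ₁ a| * |emb F σ₂ a|) := by
          have := one_le_abs_emb_mul h2 hne ha
          gcongr
        _ = (δ₁ * |emb F σ₁ a|) * (δ₂ * |emb F σ₂ a|) := by ring
        _ ≤ _ := by gcongr
    by_cases hc : (bottomRow γ).1 = 0
    · refine key _ (fun hd => ?_) hd₁ hd₂
      have hdet := γ.det_coe
      rw [Matrix.det_fin_two] at hdet
      simp only [bottomRow] at hc hd
      rw [hc, hd] at hdet
      simp at hdet
    · exact key _ hc hc₁ hc₂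
  have hR0 : 0 < R := by linarith
  have b1 : δ / R ≤ ‖jfac (mat F σ₁ γ) z₁‖ := by
    refine hκδ.trans (abs_le_of_sq_le_sq' ?_ (norm_nonneg _)).2
    nlinarith [norm_nonneg (jfac (mat F σ₁ γ) z₁)]
  have b2 : δ / R ≤ ‖jfac (mat F σ₂ γ) z₂‖ := by
    refine (abs_le_of_sq_le_sq' ?_ (norm_nonneg _)).2
    rw [div_pow, div_le_iff₀ (by positivity)]
    have hb := norm_nonneg (jfac (mat F σ₂ γ) z₂)
    calc δ ^ 2 ≤ _ := hJ
      _ ≤ (R * ‖jfac (mat F σ₂ γ) z₂‖) * ‖jfac (mat F σ₂ γ) z₂‖ := by gcongr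
      _ = ‖jfac (mat F σ₂ γ) z₂‖ ^ 2 * (R * 1) := by ring
      _ ≤ ‖jfac (mat F σ₂ γ) z₂‖ ^ 2 * (R * R) := by gcongr
      _ = _ := by ring
  have hmax {a b : ℝ} (h : δ / R ≤ b) (h' : δ / R * |a| ≤ b) : δ / R * max 1 |a| ≤ b := by
    rw [mul_max_of_nonneg _ _ (by positivity), mul_one]
    exact max_le h h'
  have hle (x : ℝ) {d : ℝ} (hd : δ ≤ d) : δ / R * |x| ≤ d * |x| := by gcongr; exact hκδ.trans hd
  exact ⟨⟨hmax b1 ((hle _ hδ1).trans hc₁), hmax b1 ((hle _ hδ1).trans hd₁)⟩,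
    hmax b2 ((hle _ hδ2).trans hc₂), hmax b2 ((hle _ hδ2).trans hd₂)⟩

end BottomRow

section CohenSummability

variable {F} {σ₁ σ₂ : F →+* ℝ}

open NumberField

/-- The absolute value of the norm of `γz`. -/
def normMoebius (σ₁ σ₂ : F →+* ℝ) (z₁ z₂ : ℂ) (γ : SL2O F) : ℝ :=
  ‖moebius (mat F σ₁ γ) z₁‖ * ‖moebius (mat F σ₂ γ) z₂‖

/-- The absolute value of the norm of `j(γ, z)`. -/
def normJfac (σ₁ σ₂ : F →+* ℝ) (z₁ z₂ : ℂ) (γ : SL2O F) : ℝ :=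
  ‖jfac (mat F σ₁ γ) z₁‖ * ‖jfac (mat F σ₂ γ) z₂‖

open Classical in
/-- A majorant of the Cohen summand over the matrices with `1 ≤ |N(γz)|`. -/
def tailBound (σ₁ σ₂ : F →+* ℝ) (τ : ℝ) (k : ℕ) (z₁ z₂ : ℂ) (γ : SL2O F) : ℝ :=
  if 1 ≤ normMoebius σ₁ σ₂ z₁ z₂ γ then
    normMoebius σ₁ σ₂ z₁ z₂ γ ^ (-τ) * normJfac σ₁ σ₂ z₁ z₂ γ ^ (-(k : ℝ))
  else 0

lemma tailBound_nonneg (τ : ℝ) (k : ℕ) (z₁ z₂ : ℂ) (γ : SL2O F) :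
    0 ≤ tailBound σ₁ σ₂ τ k z₁ z₂ γ := by
  rw [tailBound]
  split_ifs
  · rw [normMoebius, normJfac]; positivity
  · exact le_rfl

lemma moebius_mat_ne_zero (σ : F →+* ℝ) (γ : SL2O F) {z : ℂ} (hz : 0 < z.im) :
    moebius (mat F σ γ) z ≠ 0 := by
  intro h
  have := moebius_mat_im_pos σ γ hz
  simp [h] at this

lemma normMoebius_pos {z₁ z₂ : ℂ} (hz₁ : 0 < z₁.im) (hz₂ : 0 < z₂.im) (γ : SL2O F) :
    0 < normMoebius σ₁ σ₂ z₁ z₂ γ :=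
  mul_pos (norm_pos_iff.mpr (moebius_mat_ne_zero σ₁ γ hz₁))
    (norm_pos_iff.mpr (moebius_mat_ne_zero σ₂ γ hz₂))

lemma normJfac_pos {z₁ z₂ : ℂ} (hz₁ : 0 < z₁.im) (hz₂ : 0 < z₂.im) (γ : SL2O F) :
    0 < normJfac σ₁ σ₂ z₁ z₂ γ :=
  mul_pos (norm_pos_iff.mpr (jfac_mat_ne_zero σ₁ γ hz₁))
    (norm_pos_iff.mpr (jfac_mat_ne_zero σ₂ γ hz₂))

lemma norm_cohenSummand_le (k : ℕ) (s : ℂ) {z₁ z₂ : ℂ} (hz₁ : 0 < z₁.im) (hz₂ : 0 < z₂.im)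
    (γ : SL2O F) : ‖cohenSummand F σ₁ σ₂ k s z₁ z₂ γ‖ ≤ Real.exp (Real.pi * |s.im|) ^ 2 *
      (normMoebius σ₁ σ₂ z₁ z₂ γ ^ (-s.re) * normJfac σ₁ σ₂ z₁ z₂ γ ^ (-(k : ℝ))) := by
  have b₁ := norm_cpow_neg_le s (moebius_mat_ne_zero σ₁ γ hz₁)
  have b₂ := norm_cpow_neg_le s (moebius_mat_ne_zero σ₂ γ hz₂)
  rw [cohenSummand, norm_mul, norm_mul, norm_mul, norm_zpow, norm_zpow, ← mul_zpow, normMoebius,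
    normJfac, Real.mul_rpow (norm_nonneg _) (norm_nonneg _)]
  have hz : (‖jfac (mat F σ₁ γ) z₁‖ * ‖jfac (mat F σ₂ γ) z₂‖) ^ (-(k : ℤ)) =
      (‖jfac (mat F σ₁ γ) z₁‖ * ‖jfac (mat F σ₂ γ) z₂‖) ^ (-(k : ℝ)) := by
    rw [← Real.rpow_intCast]; simp
  rw [hz]
  have hb := mul_le_mul b₁ b₂ (norm_nonneg _) ((norm_nonneg _).trans b₁)
  exact (mul_le_mul_of_nonneg_right hb (by positivity)).trans_eq (by ring)

lemma norm_cohenSummand_le_of_one_le {τ : ℝ} (k : ℕ) {s : ℂ} (hτ : τ ≤ s.re) {z₁ z₂ : ℂ}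
    (hz₁ : 0 < z₁.im) (hz₂ : 0 < z₂.im) {γ : SL2O F} (h : 1 ≤ normMoebius σ₁ σ₂ z₁ z₂ γ) :
    ‖cohenSummand F σ₁ σ₂ k s z₁ z₂ γ‖ ≤
      Real.exp (Real.pi * |s.im|) ^ 2 * tailBound σ₁ σ₂ τ k z₁ z₂ γ := by
  refine (norm_cohenSummand_le k s hz₁ hz₂ γ).trans ?_
  have hJ := normJfac_pos (σ₁ := σ₁) (σ₂ := σ₂) hz₁ hz₂ γ
  rw [tailBound, if_pos h]
  gcongr

lemma normMoebius_invElt_mul {z₁ z₂ : ℂ} (hz₁ : 0 < z₁.im) (hz₂ : 0 < z₂.im) (γ : SL2O F) :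
    normMoebius σ₁ σ₂ z₁ z₂ (invElt F * γ) = (normMoebius σ₁ σ₂ z₁ z₂ γ)⁻¹ := by
  rw [normMoebius, moebius_invElt_mul _ _ hz₁, moebius_invElt_mul _ _ hz₂, norm_neg, norm_neg,
    norm_inv, norm_inv, ← mul_inv, normMoebius]

lemma normJfac_invElt_mul {z₁ z₂ : ℂ} (hz₁ : 0 < z₁.im) (hz₂ : 0 < z₂.im) (γ : SL2O F) :
    normJfac σ₁ σ₂ z₁ z₂ (invElt F * γ) =
      normMoebius σ₁ σ₂ z₁ z₂ γ * normJfac σ₁ σ₂ z₁ z₂ γ := by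
  rw [normJfac, jfac_invElt_mul _ _ hz₁, jfac_invElt_mul _ _ hz₂, norm_mul, norm_mul, normMoebius,
    normJfac]
  ring

lemma norm_cohenSummand_le_of_le_one {τ : ℝ} (k : ℕ) {s : ℂ} (hτ : τ ≤ k - s.re) {z₁ z₂ : ℂ}
    (hz₁ : 0 < z₁.im) (hz₂ : 0 < z₂.im) {γ : SL2O F} (h : normMoebius σ₁ σ₂ z₁ z₂ γ ≤ 1) :
    ‖cohenSummand F σ₁ σ₂ k s z₁ z₂ γ‖ ≤
      Real.exp (Real.pi * |s.im|) ^ 2 * tailBound σ₁ σ₂ τ k z₁ z₂ (invElt F * γ) := by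
  refine (norm_cohenSummand_le k s hz₁ hz₂ γ).trans ?_
  have hJ := normJfac_pos (σ₁ := σ₁) (σ₂ := σ₂) hz₁ hz₂ γ
  have hN := normMoebius_pos (σ₁ := σ₁) (σ₂ := σ₂) hz₁ hz₂ γ
  rw [tailBound, normMoebius_invElt_mul hz₁ hz₂, normJfac_invElt_mul hz₁ hz₂,
    if_pos ((one_le_inv₀ hN).mpr h), Real.mul_rpow hN.le hJ.le,
    ← mul_assoc (_ ^ (-τ)), Real.inv_rpow hN.le, ← Real.rpow_neg hN.le, neg_neg,
    ← Real.rpow_add hN]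
  have key : normMoebius σ₁ σ₂ z₁ z₂ γ ^ (-s.re) ≤ normMoebius σ₁ σ₂ z₁ z₂ γ ^ (τ + -(k : ℝ)) :=
    Real.rpow_le_rpow_of_exponent_ge hN h (by linarith)
  gcongr _ * (?_ * _)

lemma exists_tsum_bottomRow_le (h2 : Module.finrank ℚ F = 2) (hne : σ₁ ≠ σ₂) {τ : ℝ} (hτ : 1 < τ)
    (k : ℕ) : ∃ C : ENNReal, C ≠ ⊤ ∧ ∀ {z₁ z₂ : ℂ}, 0 < z₁.im → 0 < z₂.im →
      ∀ (γ₀ : SL2O F) {ι : Type} (g : ι → SL2O F), Function.Injective g →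
        (∀ i, bottomRow (g i) = bottomRow γ₀) →
        ∑' i, ENNReal.ofReal (tailBound σ₁ σ₂ τ k z₁ z₂ (g i)) ≤
          ENNReal.ofReal (normJfac σ₁ σ₂ z₁ z₂ γ₀ ^ (-(k : ℝ)) *
            (1 + (moebius (mat F σ₁ γ₀) z₁).im ^ (-τ) +
              (moebius (mat F σ₂ γ₀) z₂).im ^ (-τ))) * C := by
  obtain ⟨C, hC, hbound⟩ := exists_tsum_decay_le hτ
  refine ⟨C, hC, fun {z₁ z₂} hz₁ hz₂ γ₀ {ι} g hg hrow => ?_⟩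
  choose β hβ using fun i => exists_transElt_of_bottomRow_eq (hrow i)
  have hβinj (i j : ι) (hij : i ≠ j) : β i ≠ β j := fun h => hij (hg (by rw [hβ i, hβ j, h]))
  have hJ := normJfac_pos (σ₁ := σ₁) (σ₂ := σ₂) hz₁ hz₂ γ₀
  have hW₁ := moebius_mat_im_pos σ₁ γ₀ hz₁
  have hW₂ := moebius_mat_im_pos σ₂ γ₀ hz₂
  set A := normJfac σ₁ σ₂ z₁ z₂ γ₀ ^ (-(k : ℝ)) * (1 + (moebius (mat F σ₁ γ₀) z₁).im ^ (-τ) +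
    (moebius (mat F σ₂ γ₀) z₂).im ^ (-τ)) with hA
  have hA0 : 0 ≤ A := by positivity
  have hterm (i : ι) : tailBound σ₁ σ₂ τ k z₁ z₂ (g i) ≤
      A * (decay τ ((moebius (mat F σ₁ γ₀) z₁).re + emb F σ₁ (β i)) *
        decay τ ((moebius (mat F σ₂ γ₀) z₂).re + emb F σ₂ (β i))) := by
    have hd := mul_nonneg (decay_nonneg τ ((moebius (mat F σ₁ γ₀) z₁).re + emb F σ₁ (β i)))
      (decay_nonneg τ ((moebius (mat F σ₂ γ₀) z₂).re + emb F σ₂ (β i)))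
    rw [tailBound]
    split_ifs with h
    · rw [hβ i, normMoebius, moebius_transElt_mul _ _ hz₁, moebius_transElt_mul _ _ hz₂] at h ⊢
      rw [normJfac, jfac_transElt_mul _ _ hz₁, jfac_transElt_mul _ _ hz₂, ← normJfac]
      have := norm_mul_rpow_neg_le_decay (τ := τ) (by linarith)
        (w₁ := moebius (mat F σ₁ γ₀) z₁ + (emb F σ₁ (β i) : ℝ))
        (w₂ := moebius (mat F σ₂ γ₀) z₂ + (emb F σ₂ (β i) : ℝ))
        (by simpa using hW₁) (by simpa using hW₂) h
      simp only [Complex.add_im, Complex.ofReal_im, add_zero, Complex.add_re,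
        Complex.ofReal_re] at this
      rw [mul_comm, hA, mul_assoc (normJfac σ₁ σ₂ z₁ z₂ γ₀ ^ (-(k : ℝ)))]
      gcongr
    · exact mul_nonneg hA0 hd
  calc ∑' i, ENNReal.ofReal (tailBound σ₁ σ₂ τ k z₁ z₂ (g i))
      ≤ ∑' i, ENNReal.ofReal A * ENNReal.ofReal
          (decay τ ((moebius (mat F σ₁ γ₀) z₁).re + emb F σ₁ (β i)) *
            decay τ ((moebius (mat F σ₂ γ₀) z₂).re + emb F σ₂ (β i))) := by
        refine ENNReal.tsum_le_tsum fun i => ?_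
        rw [← ENNReal.ofReal_mul hA0]
        exact ENNReal.ofReal_le_ofReal (hterm i)
    _ ≤ ENNReal.ofReal A * C := by
        rw [ENNReal.tsum_mul_left]
        gcongr
        exact hbound (fun i => emb F σ₁ (β i)) (fun i => emb F σ₂ (β i))
          (fun i j hij => abs_emb_sub_mul h2 hne _ _ (hβinj i j hij)) _ _

lemma exists_normJfac_bound (h2 : Module.finrank ℚ F = 2) (hne : σ₁ ≠ σ₂) {R : ℝ} (hR : 1 ≤ R)
    {τ : ℝ} (hτ : 0 < τ) {k : ℕ} (hk : τ ≤ k) {z₁ z₂ : ℂ} (hz₁ : 0 < z₁.im) (hz₂ : 0 < z₂.im) :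
    ∃ K : ℝ, 0 ≤ K ∧ ∀ γ : SL2O F, Balanced σ₁ σ₂ R z₁ z₂ γ →
      normJfac σ₁ σ₂ z₁ z₂ γ ^ (-(k : ℝ)) *
        (1 + (moebius (mat F σ₁ γ) z₁).im ^ (-τ) + (moebius (mat F σ₂ γ) z₂).im ^ (-τ)) ≤
      K * ((decay ((k - τ) / 2) (emb F σ₁ (bottomRow γ).1) *
          decay ((k - τ) / 2) (emb F σ₂ (bottomRow γ).1)) *
        (decay ((k - τ) / 2) (emb F σ₁ (bottomRow γ).2) *
          decay ((k - τ) / 2) (emb F σ₂ (bottomRow γ).2))) := by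
  obtain ⟨κ, hκ, hκ1, H⟩ := exists_lower_bound_of_balanced h2 hne hR hz₁ hz₂
  set p := (k - τ) / 2 with hp
  have hp0 : 0 ≤ p := by rw [hp]; linarith
  set A := (κ * κ) ^ (-τ) + (z₁.im ^ (-τ) + z₂.im ^ (-τ)) * R ^ τ with hA
  have hA0 : 0 ≤ A := by positivity
  refine ⟨A * (((κ * κ) ^ (-p)) * ((κ * κ) ^ (-p))), by positivity, fun γ hγ => ?_⟩
  obtain ⟨⟨c₁, d₁⟩, c₂, d₂⟩ := H γ hγ
  obtain ⟨hb1, hb2⟩ := hγ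
  have hJ := normJfac_pos (σ₁ := σ₁) (σ₂ := σ₂) hz₁ hz₂ γ
  have hj₁ := norm_pos_iff.mpr (jfac_mat_ne_zero σ₁ γ hz₁)
  have hj₂ := norm_pos_iff.mpr (jfac_mat_ne_zero σ₂ γ hz₂)
  rw [moebius_im (mat_det σ₁ γ), moebius_im (mat_det σ₂ γ)]
  set J := normJfac σ₁ σ₂ z₁ z₂ γ with hJdef
  set a := ‖jfac (mat F σ₁ γ) z₁‖
  set b := ‖jfac (mat F σ₂ γ) z₂‖
  have hJab : J = a * b := rfl
  have lower {x y : ℝ} (hx : κ * max 1 |x| ≤ a) (hy : κ * max 1 |y| ≤ b) :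
      J ^ (-p) ≤ (κ * κ) ^ (-p) * (decay p x * decay p y) := by
    have hx0 : 0 < max 1 |x| := lt_max_of_lt_left one_pos
    have hy0 : 0 < max 1 |y| := lt_max_of_lt_left one_pos
    rw [decay, decay, ← Real.mul_rpow hx0.le hy0.le,
      ← Real.mul_rpow (by positivity) (by positivity)]
    refine Real.rpow_le_rpow_of_nonpos (by positivity) ?_ (by linarith)
    calc κ * κ * (max 1 |x| * max 1 |y|) = (κ * max 1 |x|) * (κ * max 1 |y|) := by ring
      _ ≤ a * b := by gcongr
  have hκJ : κ * κ ≤ J := by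
    have h1 : κ ≤ a := le_trans (le_mul_of_one_le_right hκ.le (le_max_left _ _)) c₁
    have h2 : κ ≤ b := le_trans (le_mul_of_one_le_right hκ.le (le_max_left _ _)) c₂
    rw [hJab]
    gcongr
  have h1 : 1 ≤ (κ * κ) ^ (-τ) * J ^ τ := by
    rw [Real.rpow_neg (by positivity), inv_mul_eq_div, one_le_div (by positivity)]
    gcongr
  have himag {y x : ℝ} (hy : 0 < y) (hx : 0 < x) (hxJ : x ^ 2 ≤ R * J) :
      (y / x ^ 2) ^ (-τ) ≤ y ^ (-τ) * (R ^ τ * J ^ τ) := by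
    rw [Real.div_rpow hy.le (by positivity), Real.rpow_neg (sq_nonneg x), div_inv_eq_mul,
      ← Real.mul_rpow (by linarith) hJ.le]
    gcongr
  have i1 := himag hz₁ hj₁ (by rw [hJab]; nlinarith)
  have i2 := himag hz₂ hj₂ (by
    rw [hJab]
    nlinarith [mul_nonneg (mul_nonneg hj₁.le hj₂.le) (sub_nonneg.mpr hR)])
  have hpow : J ^ (-(k : ℝ)) * J ^ τ = J ^ (-p) * J ^ (-p) := by
    rw [← Real.rpow_add hJ, ← Real.rpow_add hJ]
    congr 1
    rw [hp]; ring
  have hd (x : ℝ) := decay_nonneg p x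
  calc J ^ (-(k : ℝ)) * (1 + (z₁.im / a ^ 2) ^ (-τ) + (z₂.im / b ^ 2) ^ (-τ))
      ≤ J ^ (-(k : ℝ)) * ((κ * κ) ^ (-τ) * J ^ τ + z₁.im ^ (-τ) * (R ^ τ * J ^ τ) +
          z₂.im ^ (-τ) * (R ^ τ * J ^ τ)) := by gcongr
    _ = A * (J ^ (-(k : ℝ)) * J ^ τ) := by rw [hA]; ring
    _ = A * (J ^ (-p) * J ^ (-p)) := by rw [hpow]
    _ ≤ A * (((κ * κ) ^ (-p) * (decay p (emb F σ₁ (bottomRow γ).1) *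
          decay p (emb F σ₂ (bottomRow γ).1))) * ((κ * κ) ^ (-p) *
          (decay p (emb F σ₁ (bottomRow γ).2) * decay p (emb F σ₂ (bottomRow γ).2)))) := by
        have l1 := lower c₁ c₂
        have l2 := lower d₁ d₂
        have hJp : 0 ≤ J ^ (-p) := by positivity
        gcongr
        exact hJp.trans l1
    _ = _ := by ring

lemma summable_tailBound (h2 : Module.finrank ℚ F = 2) (hne : σ₁ ≠ σ₂) {R : ℝ} (hR : 1 ≤ R)
    {τ : ℝ} (hτ : 1 < τ) {k : ℕ} (hk : 1 < (k - τ) / 2) {z₁ z₂ : ℂ} (hz₁ : 0 < z₁.im)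
    (hz₂ : 0 < z₂.im) :
    Summable fun γ : {γ : SL2O F // Balanced σ₁ σ₂ R z₁ z₂ γ} =>
      tailBound σ₁ σ₂ τ k z₁ z₂ γ.1 := by
  obtain ⟨C, hC, hfibre⟩ := exists_tsum_bottomRow_le h2 hne hτ k
  obtain ⟨K, hK, hbound⟩ := exists_normJfac_bound h2 hne hR (by linarith) (k := k)
    (by linarith) hz₁ hz₂ (τ := τ)
  set p := (k - τ) / 2
  let row : {γ : SL2O F // Balanced σ₁ σ₂ R z₁ z₂ γ} → 𝓞 F × 𝓞 F := fun γ => bottomRow γ.1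
  let D : 𝓞 F → ℝ := fun a => decay p (emb F σ₁ a) * decay p (emb F σ₂ a)
  have hD0 (a : 𝓞 F) : 0 ≤ D a := mul_nonneg (decay_nonneg _ _) (decay_nonneg _ _)
  have hD : ∑' a, ENNReal.ofReal (D a) ≠ ⊤ := by
    obtain ⟨C', hC', h⟩ := exists_tsum_decay_le hk
    have := h (emb F σ₁) (emb F σ₂) (abs_emb_sub_mul h2 hne) 0 0
    simp only [zero_add] at this
    exact ne_top_of_le_ne_top hC' this
  have hrow (v : 𝓞 F × 𝓞 F) :
      ∑' γ : {γ // row γ = v}, ENNReal.ofReal (tailBound σ₁ σ₂ τ k z₁ z₂ γ.1.1) ≤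
        ENNReal.ofReal K * C * (ENNReal.ofReal (D v.1) * ENNReal.ofReal (D v.2)) := by
    rcases isEmpty_or_nonempty {γ // row γ = v} with hemp | ⟨⟨γ₀, hγ₀⟩⟩
    · simp
    · refine (hfibre hz₁ hz₂ γ₀.1 (fun γ : {γ // row γ = v} => γ.1.1)
        (Subtype.val_injective.comp Subtype.val_injective)
        (fun γ => γ.2.trans hγ₀.symm)).trans ?_
      have hb := ENNReal.ofReal_le_ofReal (hbound γ₀.1 γ₀.2)
      change _ ≤ ENNReal.ofReal (K * (D (row γ₀).1 * D (row γ₀).2)) at hb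
      rw [hγ₀, ENNReal.ofReal_mul hK, ENNReal.ofReal_mul (hD0 _)] at hb
      calc _ ≤ (ENNReal.ofReal K * (ENNReal.ofReal (D v.1) * ENNReal.ofReal (D v.2))) * C := by
            gcongr
        _ = _ := by ring
  have hfin : ∑' γ : {γ : SL2O F // Balanced σ₁ σ₂ R z₁ z₂ γ},
      ENNReal.ofReal (tailBound σ₁ σ₂ τ k z₁ z₂ γ.1) ≠ ⊤ := by
    rw [← (Equiv.sigmaFiberEquiv row).tsum_eq, ENNReal.tsum_sigma']
    refine ne_top_of_le_ne_top ?_ (ENNReal.tsum_le_tsum hrow)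
    rw [ENNReal.tsum_mul_left, ENNReal.tsum_prod']
    simp_rw [ENNReal.tsum_mul_left, ENNReal.tsum_mul_right]
    exact ENNReal.mul_ne_top (ENNReal.mul_ne_top ENNReal.ofReal_ne_top hC)
      (ENNReal.mul_ne_top hD hD)
  refine (ENNReal.summable_toReal hfin).congr fun γ => ?_
  rw [ENNReal.toReal_ofReal (tailBound_nonneg _ _ _ _ _)]

lemma invElt_mul_diagElt (ε : (𝓞 F)ˣ) : invElt F * diagElt ε⁻¹ = diagElt ε * invElt F := by
  apply Subtype.ext
  rw [Matrix.SpecialLinearGroup.coe_mul, Matrix.SpecialLinearGroup.coe_mul]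
  simp [invElt, diagElt]

lemma normMoebius_diagElt_mul (h2 : Module.finrank ℚ F = 2) (hne : σ₁ ≠ σ₂) {ε : (𝓞 F)ˣ}
    (h : PosUnit σ₁ σ₂ ε) {z₁ z₂ : ℂ} (hz₁ : 0 < z₁.im) (hz₂ : 0 < z₂.im) (γ : SL2O F) :
    normMoebius σ₁ σ₂ z₁ z₂ (diagElt ε * γ) = normMoebius σ₁ σ₂ z₁ z₂ γ := by
  rw [normMoebius, moebius_diagElt_mul _ _ hz₁, moebius_diagElt_mul _ _ hz₂, norm_mul, norm_mul,
    Complex.norm_real, Complex.norm_real, mul_mul_mul_comm, ← norm_mul, ← mul_pow,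
    h.emb_mul h2 hne]
  simp [normMoebius]

lemma diagElt_mul_rel {ε : (𝓞 F)ˣ} (h : PosUnit σ₁ σ₂ ε) (γ : SL2O F) :
    Quot.mk (ARel F σ₁ σ₂) (diagElt ε * γ) = Quot.mk _ γ :=
  (Quot.sound ⟨diagElt ε, isInA_iff.mpr ⟨ε, h, rfl⟩, rfl⟩).symm

/-- The Cohen kernel converges absolutely. -/
lemma summable_cohenSummand (h2 : Module.finrank ℚ F = 2) (hne : σ₁ ≠ σ₂) {k : ℕ} (hk : 4 ≤ k)
    {s : ℂ} (hs1 : 2 < s.re) (hs2 : s.re < (k : ℝ) - 1) {z₁ z₂ : ℂ} (hz₁ : 0 < z₁.im)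
    (hz₂ : 0 < z₂.im) {f : Quot (ARel F σ₁ σ₂) → ℂ}
    (hf : ∀ γ : SL2O F, f (Quot.mk _ γ) = cohenSummand F σ₁ σ₂ k s z₁ z₂ γ) : Summable f := by
  obtain ⟨R, hR, hbal⟩ := exists_balanced h2 hne
  have hk4 : (4 : ℝ) ≤ k := by exact_mod_cast hk
  set τ := min (3 / 2) ((k : ℝ) - s.re) with hτdef
  have hτ1 : 1 < τ := lt_min (by norm_num) (by linarith)
  have hτ2 : τ ≤ 3 / 2 := min_le_left _ _
  have hτ3 : τ ≤ (k : ℝ) - s.re := min_le_right _ _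
  have hsum := summable_tailBound h2 hne hR hτ1 (k := k) (by linarith) hz₁ hz₂
  have hrep (q : Quot (ARel F σ₁ σ₂)) : ∃ γ δ : SL2O F, Quot.mk _ γ = q ∧ Quot.mk _ δ = q ∧
      Balanced σ₁ σ₂ R z₁ z₂ γ ∧ Balanced σ₁ σ₂ R z₁ z₂ (invElt F * δ) ∧
      normMoebius σ₁ σ₂ z₁ z₂ γ = normMoebius σ₁ σ₂ z₁ z₂ δ := by
    induction q using Quot.ind with
    | mk γ₀ =>
      obtain ⟨ε, hε, hb⟩ := hbal hz₁ hz₂ γ₀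
      obtain ⟨η, hη, hb'⟩ := hbal hz₁ hz₂ (invElt F * γ₀)
      refine ⟨diagElt ε * γ₀, diagElt η⁻¹ * γ₀, diagElt_mul_rel hε _, diagElt_mul_rel hη.inv _, hb,
        ?_, ?_⟩
      · rwa [← mul_assoc, invElt_mul_diagElt, mul_assoc]
      · rw [normMoebius_diagElt_mul h2 hne hε hz₁ hz₂,
          normMoebius_diagElt_mul h2 hne hη.inv hz₁ hz₂]
  choose γ δ hγ hδ hbγ hbδ hN using hrep
  have s1 := hsum.comp_injective (i := fun q => ⟨γ q, hbγ q⟩) fun q q' h => by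
    have := congrArg Subtype.val h
    rw [← hγ q, ← hγ q']
    exact congrArg _ this
  have s2 := hsum.comp_injective (i := fun q => ⟨invElt F * δ q, hbδ q⟩) fun q q' h => by
    have := mul_left_cancel (congrArg Subtype.val h)
    rw [← hδ q, ← hδ q']
    exact congrArg _ this
  refine Summable.of_norm_bounded ((s1.add s2).mul_left (Real.exp (Real.pi * |s.im|) ^ 2))
    fun q => ?_
  have n1 : 0 ≤ tailBound σ₁ σ₂ τ k z₁ z₂ (γ q) := tailBound_nonneg _ _ _ _ _
  have n2 : 0 ≤ tailBound σ₁ σ₂ τ k z₁ z₂ (invElt F * δ q) := tailBound_nonneg _ _ _ _ _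
  simp only [Function.comp_apply]
  rcases le_total 1 (normMoebius σ₁ σ₂ z₁ z₂ (γ q)) with h | h
  · rw [← hγ q, hf, hγ q]
    refine (norm_cohenSummand_le_of_one_le (τ := τ) k (by linarith) hz₁ hz₂ h).trans ?_
    gcongr
    linarith
  · rw [← hδ q, hf, hδ q]
    refine (norm_cohenSummand_le_of_le_one (τ := τ) k hτ3 hz₁ hz₂ (hN q ▸ h)).trans ?_
    gcongr
    linarith

end CohenSummability

section CosetSpaces

variable {F} {σ₁ σ₂ : F →+* ℝ}

open NumberField

lemma ARel_equivalence : Equivalence (ARel F σ₁ σ₂) where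
  refl γ := ⟨diagElt 1, isInA_iff.mpr ⟨1, by simp [PosUnit], rfl⟩, by
    have : diagElt (1 : (𝓞 F)ˣ) = 1 := by
      apply Subtype.ext
      simp [diagElt, Matrix.one_fin_two]
    rw [this, one_mul]⟩
  symm := by
    rintro γ _ ⟨a, ha, rfl⟩
    obtain ⟨ε, hε, rfl⟩ := isInA_iff.mp ha
    refine ⟨diagElt ε⁻¹, isInA_iff.mpr ⟨ε⁻¹, hε.inv, rfl⟩, ?_⟩
    have : diagElt ε⁻¹ * diagElt ε = 1 := by
      apply Subtype.ext
      rw [Matrix.SpecialLinearGroup.coe_mul]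
      simp [diagElt, Matrix.one_fin_two]
    rw [← mul_assoc, this, one_mul]
  trans := by
    rintro γ _ _ ⟨a, ha, rfl⟩ ⟨b, hb, rfl⟩
    obtain ⟨ε, hε, rfl⟩ := isInA_iff.mp ha
    obtain ⟨η, hη, rfl⟩ := isInA_iff.mp hb
    refine ⟨diagElt (η * ε), isInA_iff.mpr ⟨_, hη.mul hε, rfl⟩, ?_⟩
    have : diagElt (η * ε) = diagElt η * diagElt ε := by
      apply Subtype.ext
      rw [Matrix.SpecialLinearGroup.coe_mul]
      simp [diagElt, mul_comm]
    rw [this, mul_assoc]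

lemma GammaInfRel_equivalence : Equivalence (GammaInfRel F σ₁ σ₂) where
  refl γ := ⟨1, by simp [IsInGammaInfPos, TotPos], by rw [one_mul]⟩
  symm := by
    rintro γ _ ⟨p, ⟨h0, h1, h2⟩, rfl⟩
    refine ⟨p⁻¹, ?_, by rw [inv_mul_cancel_left]⟩
    rw [IsInGammaInfPos, Matrix.SpecialLinearGroup.SL2_inv_expl]
    exact ⟨by simpa using h0, h2, h1⟩
  trans := by
    rintro γ _ _ ⟨p, ⟨h0, h1, h2⟩, rfl⟩ ⟨q, ⟨h0', h1', h2'⟩, rfl⟩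
    refine ⟨q * p, ?_, by rw [mul_assoc]⟩
    simp only [IsInGammaInfPos, Matrix.SpecialLinearGroup.coe_mul, Matrix.mul_apply,
      Fin.sum_univ_two, h0, h0', TotPos, zero_mul, mul_zero, add_zero, zero_add, map_mul, true_and]
    exact ⟨⟨mul_pos h1'.1 h1.1, mul_pos h1'.2 h1.2⟩, mul_pos h2'.1 h2.1, mul_pos h2'.2 h2.2⟩

lemma mk_ARel_eq_iff {γ δ : SL2O F} :
    Quot.mk (ARel F σ₁ σ₂) γ = Quot.mk _ δ ↔ ARel F σ₁ σ₂ γ δ := by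
  rw [Quot.eq, ARel_equivalence.eqvGen_iff]

lemma mk_GammaInfRel_eq_iff {γ δ : SL2O F} :
    Quot.mk (GammaInfRel F σ₁ σ₂) γ = Quot.mk _ δ ↔ GammaInfRel F σ₁ σ₂ γ δ := by
  rw [Quot.eq, GammaInfRel_equivalence.eqvGen_iff]

lemma diagElt_isInGammaInfPos {ε : (𝓞 F)ˣ} (h : PosUnit σ₁ σ₂ ε) :
    IsInGammaInfPos F σ₁ σ₂ (diagElt ε) := ⟨rfl, h, h.inv⟩

lemma transElt_isInGammaInfPos (β : 𝓞 F) : IsInGammaInfPos F σ₁ σ₂ (transElt β) := by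
  simp [IsInGammaInfPos, transElt, TotPos]

lemma exists_diagElt_mul_transElt {p : SL2O F} (hp : IsInGammaInfPos F σ₁ σ₂ p) :
    ∃ (ε : (𝓞 F)ˣ) (β : 𝓞 F), PosUnit σ₁ σ₂ ε ∧ p = diagElt ε * transElt β := by
  obtain ⟨h0, h1, -⟩ := hp
  have hdet := p.det_coe
  rw [Matrix.det_fin_two, h0, mul_zero, sub_zero] at hdet
  let ε : (𝓞 F)ˣ := ⟨_, _, hdet, by rw [mul_comm]; exact hdet⟩
  refine ⟨ε, ((ε⁻¹ : (𝓞 F)ˣ) : 𝓞 F) * (p : Matrix (Fin 2) (Fin 2) (𝓞 F)) 0 1, h1, ?_⟩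
  apply Subtype.ext
  rw [Matrix.SpecialLinearGroup.coe_mul, Matrix.eta_fin_two (p : Matrix (Fin 2) (Fin 2) (𝓞 F)), h0]
  have : (ε⁻¹ : (𝓞 F)ˣ) = (p : Matrix (Fin 2) (Fin 2) (𝓞 F)) 1 1 := rfl
  have : (ε : 𝓞 F) = (p : Matrix (Fin 2) (Fin 2) (𝓞 F)) 0 0 := rfl
  simp [diagElt, transElt, *, ← mul_assoc]

/-- The projection `A\Γ → Γ∞⁺\Γ`. -/
def cosetProj (σ₁ σ₂ : F →+* ℝ) : Quot (ARel F σ₁ σ₂) → Quot (GammaInfRel F σ₁ σ₂) :=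
  Quot.map id fun γ δ h => by
    obtain ⟨a, ha, h⟩ := h
    obtain ⟨ε, hε, rfl⟩ := isInA_iff.mp ha
    exact ⟨_, diagElt_isInGammaInfPos hε, h⟩

/-- The fibres of `A\Γ → Γ∞⁺\Γ` are parametrised by translations. -/
lemma bijective_fibre (γ : SL2O F) : Function.Bijective
    (fun β : 𝓞 F => (⟨Quot.mk _ (transElt β * γ),
      (Quot.sound ⟨_, transElt_isInGammaInfPos β, rfl⟩ :
        Quot.mk (GammaInfRel F σ₁ σ₂) γ = Quot.mk _ (transElt β * γ)).symm⟩ :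
      {q // cosetProj σ₁ σ₂ q = Quot.mk _ γ})) := by
  constructor
  · intro β β' h
    obtain ⟨a, ha, h⟩ := mk_ARel_eq_iff.mp (congrArg Subtype.val h)
    obtain ⟨ε, -, rfl⟩ := isInA_iff.mp ha
    rw [← mul_assoc, mul_left_inj] at h
    have h1 := congrArg (fun g : SL2O F => (g : Matrix (Fin 2) (Fin 2) (𝓞 F)) 0 0) h
    have h2 := congrArg (fun g : SL2O F => (g : Matrix (Fin 2) (Fin 2) (𝓞 F)) 0 1) h
    simp only [Matrix.SpecialLinearGroup.coe_mul, Matrix.mul_apply, Fin.sum_univ_two] at h1 h2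
    have e1 : (1 : 𝓞 F) = ε := by simpa [transElt, diagElt] using h1
    have e2 : β' = ε * β := by simpa [transElt, diagElt] using h2
    rw [e2, ← e1, one_mul]
  · rintro ⟨q, hq⟩
    induction q using Quot.ind with
    | mk δ =>
      obtain ⟨p, hp, h⟩ := mk_GammaInfRel_eq_iff.mp (hq.symm : Quot.mk _ γ = Quot.mk _ δ)
      obtain ⟨ε, β, hε, rfl⟩ := exists_diagElt_mul_transElt hp
      refine ⟨β, Subtype.ext ?_⟩
      change Quot.mk _ (transElt β * γ) = Quot.mk _ δ
      rw [id_eq] at h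
      rw [h, mul_assoc, diagElt_mul_rel hε]

lemma tsum_fibre (h2 : Module.finrank ℚ F = 2) (hne : σ₁ ≠ σ₂) {k : ℕ} {s : ℂ} (hs : 1 < s.re)
    {z₁ z₂ : ℂ} (hz₁ : 0 < z₁.im) (hz₂ : 0 < z₂.im) {f : Quot (ARel F σ₁ σ₂) → ℂ}
    (hf : ∀ γ : SL2O F, f (Quot.mk _ γ) = cohenSummand F σ₁ σ₂ k s z₁ z₂ γ) (γ : SL2O F) :
    ∑' q : {q // cosetProj σ₁ σ₂ q = Quot.mk _ γ}, f q.1 =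
      lipschitzConst F s * outerSummand F σ₁ σ₂ k s z₁ z₂ γ := by
  rw [← (Equiv.ofBijective _ (bijective_fibre γ)).tsum_eq]
  simp only [Equiv.ofBijective_apply, hf, cohenSummand, jfac_transElt_mul _ _ hz₁,
    jfac_transElt_mul _ _ hz₂, moebius_transElt_mul _ _ hz₁, moebius_transElt_mul _ _ hz₂]
  rw [tsum_mul_right, (lipschitz_ringOfIntegers h2 hne hs (moebius_mat_im_pos σ₁ γ hz₁)
    (moebius_mat_im_pos σ₂ γ hz₂)).2, outerSummand]
  simp only [innerSummand]
  ring

end CosetSpaces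

/-- For even `k ≥ 4`, `2 < Re s < k - 1` and `z ∈ ℍ²`:
`Σ_{γ ∈ A\Γ} (γ₁z₁)^{-s}(γ₂z₂)^{-s} j(γ,z)^{-k·1}
  = (2π)^{2s}/(e^{πis}Γ(s)²√D) · Σ_{γ ∈ Γ∞⁺\Γ} j(γ,z)^{-k·1}
      Σ_{ξ ∈ (𝔡⁻¹)₊} N(ξ)^{s-1} e^{2πi(σ₁(ξ)γ₁z₁+σ₂(ξ)γ₂z₂)}`,
all summands well defined on the respective coset spaces and all series absolutely
convergent. -/
theorem statement8 (σ₁ σ₂ : F →+* ℝ) (hF : RealQuadNarrowOne F σ₁ σ₂)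
    (k : ℕ) (hkeven : Even k) (hk4 : 4 ≤ k)
    (s : ℂ) (hs1 : 2 < s.re) (hs2 : s.re < (k : ℝ) - 1)
    (z₁ z₂ : ℂ) (hz₁ : 0 < z₁.im) (hz₂ : 0 < z₂.im) :
    (∀ a γ : SL2O F, IsInA F σ₁ σ₂ a →
        cohenSummand F σ₁ σ₂ k s z₁ z₂ (a * γ) = cohenSummand F σ₁ σ₂ k s z₁ z₂ γ) ∧
    (∀ p γ : SL2O F, IsInGammaInfPos F σ₁ σ₂ p →
        outerSummand F σ₁ σ₂ k s z₁ z₂ (p * γ) = outerSummand F σ₁ σ₂ k s z₁ z₂ γ) ∧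
    (∀ γ : SL2O F, Summable (innerSummand F σ₁ σ₂ s z₁ z₂ γ)) ∧
    ∀ (f : Quot (ARel F σ₁ σ₂) → ℂ),
      (∀ γ : SL2O F, f (Quot.mk _ γ) = cohenSummand F σ₁ σ₂ k s z₁ z₂ γ) →
      ∀ (g : Quot (GammaInfRel F σ₁ σ₂) → ℂ),
        (∀ γ : SL2O F, g (Quot.mk _ γ) = outerSummand F σ₁ σ₂ k s z₁ z₂ γ) →
        Summable f ∧ Summable g ∧
        (∑' q, f q)
          = ((2 * Real.pi : ℝ) : ℂ) ^ (2 * s) /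
              (Complex.exp (Real.pi * Complex.I * s) * Complex.Gamma s ^ 2 *
                ((Real.sqrt (NumberField.discr F : ℝ) : ℝ) : ℂ)) *
            ∑' q, g q := by
  obtain ⟨h2, hne, -⟩ := hF
  have hs : 1 < s.re := by linarith
  have hA (a γ : SL2O F) (ha : IsInA F σ₁ σ₂ a) :
      cohenSummand F σ₁ σ₂ k s z₁ z₂ (a * γ) = cohenSummand F σ₁ σ₂ k s z₁ z₂ γ := by
    obtain ⟨ε, hε, rfl⟩ := isInA_iff.mp ha
    exact cohenSummand_diagElt_mul h2 hne k s hz₁ hz₂ hε γ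
  refine ⟨hA, fun p γ hp => ?_, fun γ => (lipschitz_ringOfIntegers h2 hne hs
    (moebius_mat_im_pos σ₁ γ hz₁) (moebius_mat_im_pos σ₂ γ hz₂)).1, fun f hf g hg => ?_⟩
  · let f : Quot (ARel F σ₁ σ₂) → ℂ := Quot.lift (cohenSummand F σ₁ σ₂ k s z₁ z₂) (by
      rintro γ _ ⟨a, ha, rfl⟩
      exact (hA a γ ha).symm)
    have hfib := tsum_fibre h2 hne hs hz₁ hz₂ (f := f) fun _ => rfl
    apply mul_left_cancel₀ (lipschitzConst_ne_zero hs h2 hne)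
    have hγ : Quot.mk (GammaInfRel F σ₁ σ₂) γ = Quot.mk _ (p * γ) := Quot.sound ⟨p, hp, rfl⟩
    rw [← hfib, ← hfib, hγ]
  · have hfsum := summable_cohenSummand h2 hne hk4 hs1 hs2 hz₁ hz₂ hf
    have hfib (q : Quot (GammaInfRel F σ₁ σ₂)) :
        ∑' r : {r // cosetProj σ₁ σ₂ r = q}, f r.1 = lipschitzConst F s * g q := by
      induction q using Quot.ind with
      | mk γ => rw [tsum_fibre h2 hne hs hz₁ hz₂ hf, hg]
    have hsig : Summable fun x : (q : Quot (GammaInfRel F σ₁ σ₂)) ×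
        {r // cosetProj σ₁ σ₂ r = q} => f x.2.1 :=
      (Equiv.sigmaFiberEquiv (cosetProj σ₁ σ₂)).summable_iff.mpr hfsum
    have hgsum := hsig.sigma
    simp only [hfib] at hgsum
    refine ⟨hfsum, (summable_mul_left_iff (lipschitzConst_ne_zero hs h2 hne)).mp hgsum, ?_⟩
    calc ∑' q, f q = ∑' x : (q : Quot (GammaInfRel F σ₁ σ₂)) ×
          {r // cosetProj σ₁ σ₂ r = q}, f x.2.1 :=
          ((Equiv.sigmaFiberEquiv (cosetProj σ₁ σ₂)).tsum_eq f).symm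
      _ = ∑' q, lipschitzConst F s * g q := by
          rw [hsig.tsum_sigma]
          simp only [hfib]
      _ = lipschitzConst F s * ∑' q, g q := tsum_mul_left

end HilbertPaper
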